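/- There exist constants C>0 and h_0>0, depending only on k, α, β, γ, b-a and the quasi-uniformity constant c, such that whenever h ≤ h_0, u is 2k-times continuously differentiable with u(a)=u(b)=0, f := -αu''+βu'+γu, and ū_h is a Gauss collocation solution, then |(u-ū_h)'(gl_{in})| ≤ C h^{k+1} ‖u‖_{2k,∞} at each of the k-2 interior Lobatto points gl_{in} of every element τ_i. -/

import Mathlib

open Set Finset intervalIntegral

/-- The Legendre polynomial of degree `n` (Rodrigues formula), as a real function. -/
noncomputable def legendre (n : ℕ) : ℝ → ℝ :=
  fun s => (1 / ((2 : ℝ) ^ n * n.factorial)) * iteratedDeriv n (fun t : ℝ => (t ^ 2 - 1) ^ n) s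

/-- The affine map sending `[-1,1]` onto `[p,q]`. -/
noncomputable def affMap (p q s : ℝ) : ℝ := (p + q) / 2 + s * (q - p) / 2

/-- `x 0 = a < x 1 < ... < x N = b` is a partition of `[a,b]`. -/
def IsMesh (a b : ℝ) (N : ℕ) (x : ℕ → ℝ) : Prop :=
  1 ≤ N ∧ x 0 = a ∧ x N = b ∧ ∀ i < N, x i < x (i + 1)

/-- `h` is the maximal element length `h = max_i (x i - x (i-1))`. -/
def IsMeshSize (N : ℕ) (x : ℕ → ℝ) (h : ℝ) : Prop :=
  (∀ i ∈ Finset.Icc 1 N, x i - x (i - 1) ≤ h) ∧ ∃ i ∈ Finset.Icc 1 N, x i - x (i - 1) = h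

/-- Quasi-uniformity with constant `c`: `h ≤ c · h_i` for all elements. -/
def IsQuasiUniform (N : ℕ) (x : ℕ → ℝ) (h c : ℝ) : Prop :=
  ∀ i ∈ Finset.Icc 1 N, h ≤ c * (x i - x (i - 1))

/-- `P i` are the element polynomials (degree ≤ k) of a member of `V_h^0`:
a C¹ piecewise polynomial vanishing at both ends of `[a,b]`. -/
def IsVh0 (k N : ℕ) (x : ℕ → ℝ) (P : ℕ → Polynomial ℝ) : Prop :=
  (∀ i ∈ Finset.Icc 1 N, (P i).natDegree ≤ k) ∧
  (∀ i ∈ Finset.Icc 1 (N - 1), (P i).eval (x i) = (P (i + 1)).eval (x i)) ∧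
  (∀ i ∈ Finset.Icc 1 (N - 1),
      (Polynomial.derivative (P i)).eval (x i) = (Polynomial.derivative (P (i + 1))).eval (x i)) ∧
  (P 1).eval (x 0) = 0 ∧ (P N).eval (x N) = 0

/-- `P i` are the element polynomials of a Petrov–Galerkin solution `u_h ∈ V_h^0`:
`∑_i ∫_{τ_i} (-α u_h'' + β u_h' + γ u_h) v_h = ∫_a^b f v_h` for all `v_h ∈ W_h`. -/
def IsPGSol (k N : ℕ) (x : ℕ → ℝ) (α β γ : ℝ) (f : ℝ → ℝ) (P : ℕ → Polynomial ℝ) : Prop :=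
  IsVh0 k N x P ∧
  ∀ Q : ℕ → Polynomial ℝ, (∀ i ∈ Finset.Icc 1 N, (Q i).natDegree ≤ k - 2) →
    (∑ i ∈ Finset.Icc 1 N, ∫ t in (x (i - 1))..(x i),
        (-α * ((Polynomial.derivative (Polynomial.derivative (P i))).eval t)
            + β * ((Polynomial.derivative (P i)).eval t) + γ * (P i).eval t) * (Q i).eval t)
      = ∑ i ∈ Finset.Icc 1 N, ∫ t in (x (i - 1))..(x i), f t * (Q i).eval t

/-- `P i` are the element polynomials of a Gauss collocation solution `ū_h ∈ V_h^0`: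
`(-α ū_h'' + β ū_h' + γ ū_h)(g) = f(g)` at every Gauss point `g` of every element. -/
def IsGaussSol (k N : ℕ) (x : ℕ → ℝ) (α β γ : ℝ) (f : ℝ → ℝ) (P : ℕ → Polynomial ℝ) : Prop :=
  IsVh0 k N x P ∧
  ∀ i ∈ Finset.Icc 1 N, ∀ s ∈ Set.Ioo (-1 : ℝ) 1, legendre (k - 1) s = 0 →
    -α * ((Polynomial.derivative (Polynomial.derivative (P i))).eval (affMap (x (i - 1)) (x i) s))
        + β * ((Polynomial.derivative (P i)).eval (affMap (x (i - 1)) (x i) s))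
        + γ * (P i).eval (affMap (x (i - 1)) (x i) s)
      = f (affMap (x (i - 1)) (x i) s)

/-- `p` is the elementwise truncated Jacobi projection of `u` on the element `[xl, xr]`:
the polynomial of degree ≤ k matching `u` and `u'` at both endpoints with
`(u - p)'' ⊥ P_{k-2}` in `L²(xl, xr)`. -/
def IsElemProj (k : ℕ) (u : ℝ → ℝ) (xl xr : ℝ) (p : Polynomial ℝ) : Prop :=
  p.natDegree ≤ k ∧ p.eval xl = u xl ∧ p.eval xr = u xr ∧
  (Polynomial.derivative p).eval xl = deriv u xl ∧
  (Polynomial.derivative p).eval xr = deriv u xr ∧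
  ∀ q : Polynomial ℝ, q.natDegree ≤ k - 2 →
    (∫ t in xl..xr,
        (iteratedDeriv 2 u t - (Polynomial.derivative (Polynomial.derivative p)).eval t)
          * q.eval t) = 0

section LegendrePolynomial

open Polynomial

/-- The unnormalised Legendre polynomial `D^n (X^2 - 1)^n`. -/
noncomputable def rodrigues (n : ℕ) : ℝ[X] := derivative^[n] ((X ^ 2 - 1) ^ n)

lemma iteratedDeriv_polynomial_eval (p : ℝ[X]) (n : ℕ) :
    iteratedDeriv n (fun t => p.eval t) = fun t => (derivative^[n] p).eval t := by
  induction n with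
  | zero => simp
  | succ n ih =>
    rw [iteratedDeriv_succ, ih]
    ext t
    rw [Function.iterate_succ_apply', Polynomial.deriv]

lemma legendre_eq_eval_rodrigues (n : ℕ) :
    legendre n = fun s => (1 / ((2 : ℝ) ^ n * n.factorial)) * (rodrigues n).eval s := by
  have h : (fun t : ℝ => (t ^ 2 - 1) ^ n) = fun t => ((X ^ 2 - 1 : ℝ[X]) ^ n).eval t := by
    ext t; simp
  ext s
  simp only [legendre]
  rw [h, iteratedDeriv_polynomial_eval, rodrigues]

lemma legendre_eq_zero_of_rodrigues {n : ℕ} {s : ℝ} (h : (rodrigues n).eval s = 0) :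
    legendre n s = 0 := by
  simp [legendre_eq_eval_rodrigues, h]

lemma derivative_rodrigues_eq_zero {n : ℕ} {s : ℝ} (h : deriv (legendre n) s = 0) :
    (derivative (rodrigues n)).eval s = 0 := by
  rw [legendre_eq_eval_rodrigues, deriv_const_mul_field, Polynomial.deriv] at h
  have : (1 / ((2 : ℝ) ^ n * n.factorial)) ≠ 0 := by positivity
  exact (mul_eq_zero.1 h).resolve_left this

lemma natDegree_sq_sub_one_pow (n : ℕ) : ((X ^ 2 - 1 : ℝ[X]) ^ n).natDegree = 2 * n := by
  rw [natDegree_pow, show (X ^ 2 - 1 : ℝ[X]) = X ^ 2 - C 1 by simp, natDegree_X_pow_sub_C,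
    mul_comm]

lemma natDegree_iterate_derivative_eq (p : ℝ[X]) (j : ℕ) :
    (derivative^[j] p).natDegree = p.natDegree - j := by
  induction j with
  | zero => simp
  | succ j ih => rw [Function.iterate_succ_apply', natDegree_derivative, ih]; omega

lemma natDegree_rodrigues (n : ℕ) : (rodrigues n).natDegree = n := by
  rw [rodrigues, natDegree_iterate_derivative_eq, natDegree_sq_sub_one_pow]; omega

lemma iterate_derivative_sq_sub_one_pow_eval {n j : ℕ} (hj : j < n) {t : ℝ} (ht : t ^ 2 = 1) :
    (derivative^[j] ((X ^ 2 - 1 : ℝ[X]) ^ n)).eval t = 0 := by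
  have h := pow_sub_dvd_iterate_derivative_pow (X ^ 2 - 1 : ℝ[X]) n j
  obtain ⟨r, hr⟩ := h
  rw [hr, eval_mul, eval_pow]
  have : (n - j) ≠ 0 := by omega
  simp [ht, this]

lemma exists_finset_roots_iterate_derivative {n : ℕ} (j : ℕ) (hj : j ≤ n) :
    ∃ G : Finset ℝ, j ≤ G.card ∧ ∀ g ∈ G, g ∈ Set.Ioo (-1 : ℝ) 1 ∧
      (derivative^[j] ((X ^ 2 - 1 : ℝ[X]) ^ n)).eval g = 0 := by
  induction j with
  | zero => exact ⟨∅, by simp, by simp⟩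
  | succ j ih =>
    obtain ⟨G, hc, hG⟩ := ih (by omega)
    set p := derivative^[j] ((X ^ 2 - 1 : ℝ[X]) ^ n) with hp
    have hp' : derivative^[j + 1] ((X ^ 2 - 1 : ℝ[X]) ^ n) = derivative p := by
      rw [Function.iterate_succ_apply']
    have hne : derivative p ≠ 0 := by
      intro h0
      have h1 := natDegree_iterate_derivative_eq ((X ^ 2 - 1 : ℝ[X]) ^ n) j
      rw [← hp, natDegree_sq_sub_one_pow] at h1
      have : p.natDegree = 0 := Polynomial.derivative_eq_zero.1 h0
      omega
    let B : Finset ℝ := (derivative p).roots.toFinset.filter (fun g => g ∈ Set.Ioo (-1 : ℝ) 1)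
    have hA : ∀ g ∈ insert (-1) (insert 1 G), g ∈ Set.Icc (-1 : ℝ) 1 ∧ p.eval g = 0 := by
      intro g hg
      simp only [Finset.mem_insert] at hg
      rcases hg with rfl | rfl | hg
      · exact ⟨by norm_num, iterate_derivative_sq_sub_one_pow_eval (by omega) (by norm_num)⟩
      · exact ⟨by norm_num, iterate_derivative_sq_sub_one_pow_eval (by omega) (by norm_num)⟩
      · exact ⟨Set.Ioo_subset_Icc_self (hG g hg).1, (hG g hg).2⟩
    have hcard : (insert (-1) (insert 1 G)).card = G.card + 2 := by
      rw [Finset.card_insert_of_notMem, Finset.card_insert_of_notMem]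
      · intro h; have := (hG _ h).1.2; linarith
      · intro h
        rcases Finset.mem_insert.1 h with h | h
        · norm_num at h
        · have := (hG _ h).1.1; linarith
    have hB : (insert (-1) (insert 1 G)).card ≤ B.card + 1 := by
      apply Finset.card_le_of_interleaved
      intro y hy z hz hyz _
      obtain ⟨w, hw, hw0⟩ := exists_deriv_eq_zero hyz p.continuous.continuousOn
        ((hA y hy).2.trans (hA z hz).2.symm)
      rw [Polynomial.deriv] at hw0
      refine ⟨w, ?_, hw.1, hw.2⟩
      simp only [B, Finset.mem_filter, Multiset.mem_toFinset, mem_roots hne, IsRoot.def]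
      exact ⟨hw0, by linarith [(hA y hy).1.1, hw.1], by linarith [(hA z hz).1.2, hw.2]⟩
    refine ⟨B, by omega, fun g hg => ?_⟩
    simp only [B, Finset.mem_filter, Multiset.mem_toFinset, mem_roots hne, IsRoot.def] at hg
    rw [hp']
    exact ⟨hg.2, hg.1⟩

lemma exists_gauss_nodes (n : ℕ) : ∃ G : Finset ℝ, n ≤ G.card ∧
    ∀ g ∈ G, g ∈ Set.Ioo (-1 : ℝ) 1 ∧ (rodrigues n).eval g = 0 :=
  exists_finset_roots_iterate_derivative n le_rfl

lemma sq_sub_one_mul_iterate_derivative (n j : ℕ) :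
    (X ^ 2 - 1 : ℝ[X]) * derivative^[j + 2] ((X ^ 2 - 1 : ℝ[X]) ^ n)
      = C (2 * (n : ℝ) - 2 * (j + 1)) * X * derivative^[j + 1] ((X ^ 2 - 1 : ℝ[X]) ^ n)
        + C ((j + 1) * (2 * (n : ℝ) - j)) * derivative^[j] ((X ^ 2 - 1 : ℝ[X]) ^ n) := by
  induction j with
  | zero =>
    have h1 : (X ^ 2 - 1 : ℝ[X]) * derivative ((X ^ 2 - 1 : ℝ[X]) ^ n)
        = C (2 * (n : ℝ)) * X * (X ^ 2 - 1 : ℝ[X]) ^ n := by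
      rcases n with _ | n
      · simp
      · rw [derivative_pow_succ]
        simp only [derivative_sub, derivative_X_pow, derivative_one, map_mul, map_add, map_natCast,
          map_one, map_ofNat, Nat.cast_add, Nat.cast_one, Nat.cast_ofNat]
        ring
    have h2 := congrArg derivative h1
    simp only [derivative_mul, derivative_sub, derivative_X_pow, derivative_one, derivative_C,
      derivative_X] at h2
    simp only [Function.iterate_succ_apply, Function.iterate_zero_apply]
    simp only [map_sub, map_mul, map_add, map_natCast, map_one, map_ofNat, Nat.cast_zero,
      Nat.cast_ofNat, map_zero] at h2 ⊢
    linear_combination h2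
  | succ j ih =>
    have h2 := congrArg derivative ih
    simp only [derivative_mul, derivative_sub, derivative_X_pow, derivative_one, derivative_C,
      derivative_X, derivative_add, ← Function.iterate_succ_apply' derivative] at h2
    simp only [map_sub, map_mul, map_add, map_natCast, map_one, map_ofNat,
      Nat.cast_ofNat, Nat.cast_add, Nat.cast_one, Nat.succ_eq_add_one] at h2 ⊢
    rw [show j + 1 + 2 = j + 2 + 1 by ring, show j + 1 + 1 = j + 2 by ring]
    rw [show j + 1 + 1 = j + 2 by ring] at h2
    linear_combination h2

lemma iterate_derivative_eval_eq_zero_of_lobatto {n : ℕ} (hn : 1 ≤ n) {s : ℝ}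
    (hs : (derivative (rodrigues n)).eval s = 0) :
    (derivative^[n - 1] ((X ^ 2 - 1 : ℝ[X]) ^ n)).eval s = 0 := by
  obtain ⟨m, rfl⟩ : ∃ m, n = m + 1 := ⟨n - 1, by omega⟩
  have h := congrArg (eval s) (sq_sub_one_mul_iterate_derivative (m + 1) m)
  rw [rodrigues, ← Function.iterate_succ_apply' derivative] at hs
  simp only [eval_mul, eval_add, eval_C, Nat.succ_eq_add_one] at h hs
  rw [show m + 2 = m + 1 + 1 by ring, hs] at h
  simp only [Nat.cast_add, Nat.cast_one] at h
  have h3 : ((m : ℝ) + 1) * (2 * (m + 1) - m) ≠ 0 := by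
    have : (0 : ℝ) ≤ m := Nat.cast_nonneg m
    apply mul_ne_zero <;> nlinarith
  rw [sub_self, zero_mul, zero_mul, zero_add, mul_zero] at h
  simpa [h3] using h.symm

lemma integral_derivative_eval (p : ℝ[X]) (l r : ℝ) :
    ∫ t in l..r, (derivative p).eval t = p.eval r - p.eval l := by
  apply integral_eq_sub_of_hasDerivAt (fun t _ => p.hasDerivAt t)
  exact (derivative p).continuous.intervalIntegrable _ _

lemma integral_rodrigues_lobatto {n : ℕ} (hn : 1 ≤ n) {s : ℝ}
    (hs : (derivative (rodrigues n)).eval s = 0) :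
    ∫ t in (-1 : ℝ)..s, (rodrigues n).eval t = 0 := by
  obtain ⟨m, rfl⟩ : ∃ m, n = m + 1 := ⟨n - 1, by omega⟩
  have h := iterate_derivative_eval_eq_zero_of_lobatto hn hs
  rw [rodrigues, Function.iterate_succ_apply', integral_derivative_eval]
  rw [Nat.add_sub_cancel] at h
  rw [h, iterate_derivative_sq_sub_one_pow_eval (by omega) (by norm_num), sub_zero]

lemma integral_rodrigues_mul_linear {n : ℕ} (hn : 2 ≤ n) {q : ℝ[X]} (hq : q.natDegree ≤ 1) :
    ∫ t in (-1 : ℝ)..1, (rodrigues n * q).eval t = 0 := by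
  obtain ⟨m, rfl⟩ : ∃ m, n = m + 2 := ⟨n - 2, by omega⟩
  obtain ⟨a, b, rfl⟩ := exists_eq_X_add_C_of_natDegree_le_one hq
  have h : rodrigues (m + 2) * (C a * X + C b)
      = derivative (derivative^[m + 1] ((X ^ 2 - 1 : ℝ[X]) ^ (m + 2)) * (C a * X + C b)
        - C a * derivative^[m] ((X ^ 2 - 1 : ℝ[X]) ^ (m + 2))) := by
    simp only [derivative_mul, derivative_sub, derivative_C, derivative_X, derivative_add,
      ← Function.iterate_succ_apply' derivative, rodrigues]
    simp only [Nat.succ_eq_add_one, add_assoc, one_add_one_eq_two]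
    ring
  rw [h, integral_derivative_eval]
  simp only [eval_sub, eval_mul, eval_add, eval_C, eval_X]
  rw [iterate_derivative_sq_sub_one_pow_eval (by omega) (by norm_num),
    iterate_derivative_sq_sub_one_pow_eval (by omega) (by norm_num),
    iterate_derivative_sq_sub_one_pow_eval (by omega) (by norm_num),
    iterate_derivative_sq_sub_one_pow_eval (by omega) (by norm_num)]
  ring

end LegendrePolynomial

section PolynomialBounds

open Polynomial

lemma exists_bound_of_nodes (D : ℝ[X] →ₗ[ℝ] ℝ[X]) {n : ℕ} (hn : 1 ≤ n) (G : Finset ℝ)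
    (hG : n ≤ G.card) :
    ∃ C > 0, ∀ (r : ℝ[X]) (δ : ℝ), r.degree < n → (∀ g ∈ G, |r.eval g| ≤ δ) →
      ∀ s ∈ Set.Icc (-1 : ℝ) 1, |(D r).eval s| ≤ C * δ := by
  have hb : ∀ g ∈ G, ∃ B > 0, ∀ s ∈ Set.Icc (-1 : ℝ) 1,
      |(D (Lagrange.basis G id g)).eval s| ≤ B := by
    intro g _
    obtain ⟨B, hB⟩ := (isCompact_Icc (a := (-1 : ℝ)) (b := 1)).exists_bound_of_continuousOn
      (D (Lagrange.basis G id g)).continuous.continuousOn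
    exact ⟨max B 1, by positivity, fun s hs => (hB s hs).trans (le_max_left _ _)⟩
  choose! B hB0 hB using hb
  refine ⟨∑ g ∈ G, B g + 1, by have := Finset.sum_nonneg fun g hg => (hB0 g hg).le; linarith, ?_⟩
  intro r δ hr hδ s hs
  have hrep : r = Lagrange.interpolate G id fun g => r.eval g :=
    Lagrange.eq_interpolate (v := id) (fun _ _ _ _ h => h) (hr.trans_le (by exact_mod_cast hG))
  have hval : (D r).eval s = ∑ g ∈ G, r.eval g * (D (Lagrange.basis G id g)).eval s := by
    conv_lhs => rw [hrep, Lagrange.interpolate_apply]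
    simp only [map_sum, ← smul_eq_C_mul, map_smul, eval_finsetSum, eval_smul, smul_eq_mul]
  rw [hval]
  obtain ⟨g₀, hg₀⟩ : G.Nonempty := Finset.card_pos.1 (by omega)
  have hδ0 : 0 ≤ δ := (abs_nonneg _).trans (hδ g₀ hg₀)
  calc |∑ g ∈ G, r.eval g * (D (Lagrange.basis G id g)).eval s|
      ≤ ∑ g ∈ G, |r.eval g * (D (Lagrange.basis G id g)).eval s| := Finset.abs_sum_le_sum_abs _ _
    _ ≤ ∑ g ∈ G, δ * B g := by
        refine Finset.sum_le_sum fun g hg => ?_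
        rw [abs_mul]
        exact mul_le_mul (hδ g hg) (hB g hg s hs) (abs_nonneg _) hδ0
    _ ≤ (∑ g ∈ G, B g + 1) * δ := by
        rw [← Finset.mul_sum]; nlinarith

/-- The integral of a polynomial of degree at most `m` over `[-1, s]` is controlled by its values at
the Gauss nodes, as soon as the multiples of the Legendre polynomial of degree at most `m` integrate
to zero over `[-1, s]`. -/
lemma exists_integral_bound_of_nodes {n : ℕ} (hn : 1 ≤ n) (G : Finset ℝ) (hG : n ≤ G.card)
    (hroot : ∀ g ∈ G, (rodrigues n).eval g = 0) :
    ∃ C > 0, ∀ (m : ℕ), ∀ s ∈ Set.Icc (-1 : ℝ) 1,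
      (∀ q : ℝ[X], q.natDegree ≤ m - n → ∫ t in (-1 : ℝ)..s, (rodrigues n * q).eval t = 0) →
      ∀ (T : ℝ[X]) (δ : ℝ), T.natDegree ≤ m → (∀ g ∈ G, |T.eval g| ≤ δ) →
        |∫ t in (-1 : ℝ)..s, T.eval t| ≤ C * δ := by
  obtain ⟨C, hC0, hC⟩ := exists_bound_of_nodes LinearMap.id hn G hG
  refine ⟨C * 2, by positivity, fun m s hs horth T δ hT hδ => ?_⟩
  have hne : rodrigues n ≠ 0 := by
    intro h
    have := natDegree_rodrigues n
    rw [h, natDegree_zero] at this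
    omega
  have hdec := EuclideanDomain.div_add_mod T (rodrigues n)
  have hdeg : (T % rodrigues n).degree < n := by
    refine (EuclideanDomain.mod_lt T hne).trans_eq ?_
    rw [degree_eq_natDegree hne, natDegree_rodrigues]
  have hval : ∀ g ∈ G, |(T % rodrigues n).eval g| ≤ δ := by
    intro g hg
    have := hδ g hg
    rwa [← hdec, eval_add, eval_mul, hroot g hg, zero_mul, zero_add] at this
  have hq : (T / rodrigues n).natDegree ≤ m - n := by
    by_cases hle : (rodrigues n).degree ≤ T.degree
    · by_cases hz : T / rodrigues n = 0
      · simp [hz]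
      have h1 := degree_add_div hne hle
      rw [← degree_mul] at h1
      have h2 := natDegree_eq_of_degree_eq h1
      rw [natDegree_mul hne hz, natDegree_rodrigues] at h2
      omega
    · rw [(Polynomial.div_eq_zero_iff hne).2 (not_le.1 hle)]; simp
  have hintegral : ∫ t in (-1 : ℝ)..s, T.eval t = ∫ t in (-1 : ℝ)..s, (T % rodrigues n).eval t := by
    conv_lhs => rw [← hdec]
    simp only [eval_add]
    rw [intervalIntegral.integral_add ((Polynomial.continuous _).intervalIntegrable _ _)
      ((Polynomial.continuous _).intervalIntegrable _ _), horth _ hq, zero_add]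
  rw [hintegral]
  have hδ0 : 0 ≤ C * δ := (abs_nonneg _).trans (hC _ δ hdeg hval s hs)
  have := intervalIntegral.norm_integral_le_of_norm_le_const (a := (-1 : ℝ)) (b := s)
    (C := C * δ) (f := fun t => (T % rodrigues n).eval t) (by
      intro t ht
      rw [Set.uIoc_of_le hs.1] at ht
      exact hC _ δ hdeg hval t ⟨ht.1.le, ht.2.trans hs.2⟩)
  rw [Real.norm_eq_abs] at this
  refine this.trans ?_
  rw [abs_of_nonneg (by linarith [hs.1])]
  nlinarith [hs.2]

lemma affMap_mem_Icc {p q s : ℝ} (hpq : p ≤ q) (hs : s ∈ Set.Icc (-1 : ℝ) 1) :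
    affMap p q s ∈ Set.Icc p q := by
  obtain ⟨h1, h2⟩ := hs
  unfold affMap
  constructor <;> nlinarith

lemma exists_affMap_eq {p q t : ℝ} (hpq : p < q) (ht : t ∈ Set.Icc p q) :
    ∃ s ∈ Set.Icc (-1 : ℝ) 1, affMap p q s = t := by
  have h : 0 < q - p := by linarith
  refine ⟨(2 * t - p - q) / (q - p), ⟨?_, ?_⟩, ?_⟩
  · rw [le_div_iff₀ h]; linarith [ht.1]
  · rw [div_le_iff₀ h]; linarith [ht.2]
  · unfold affMap; field_simp; ring

/-- Pull back of a polynomial to the reference element. -/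
noncomputable def refPoly (p q : ℝ) (T : ℝ[X]) : ℝ[X] :=
  T.comp (C ((q - p) / 2) * X + C ((p + q) / 2))

lemma eval_refPoly (p q s : ℝ) (T : ℝ[X]) : (refPoly p q T).eval s = T.eval (affMap p q s) := by
  simp only [refPoly, eval_comp, eval_add, eval_mul, eval_C, eval_X, affMap]
  congr 1; ring

lemma natDegree_refPoly_le (p q : ℝ) (T : ℝ[X]) : (refPoly p q T).natDegree ≤ T.natDegree := by
  refine natDegree_comp_le.trans ?_
  calc _ ≤ T.natDegree * 1 := Nat.mul_le_mul_left _ natDegree_linear_le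
    _ = _ := mul_one _

lemma derivative_refPoly (p q : ℝ) (T : ℝ[X]) :
    derivative (refPoly p q T) = C ((q - p) / 2) * refPoly p q (derivative T) := by
  simp [refPoly, derivative_comp]

lemma degree_lt_of_natDegree_le {T : ℝ[X]} {n : ℕ} (h : T.natDegree ≤ n) :
    T.degree < ((n + 1 : ℕ) : WithBot ℕ) := by
  refine (degree_le_of_natDegree_le h).trans_lt ?_
  exact_mod_cast Nat.lt_succ_self n

/-- Inverse inequality for the first derivative. -/
lemma exists_inverse_inequality_derivative (n : ℕ) : ∃ C > 0, ∀ (Q : ℝ[X]) (p q B : ℝ),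
    Q.natDegree ≤ n → p < q → (∀ t ∈ Set.Icc p q, |Q.eval t| ≤ B) →
      ∀ t ∈ Set.Icc p q, |(derivative Q).eval t| ≤ C * (B / (q - p)) := by
  obtain ⟨G, hGc, hG⟩ := exists_gauss_nodes (n + 1)
  obtain ⟨C, hC0, hC⟩ := exists_bound_of_nodes derivative (by omega) G hGc
  refine ⟨C * 2, by positivity, fun Q p q B hQ hpq hB t ht => ?_⟩
  obtain ⟨s, hs, rfl⟩ := exists_affMap_eq hpq ht
  have h := hC (refPoly p q Q) B (degree_lt_of_natDegree_le ((natDegree_refPoly_le p q Q).trans hQ))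
    (fun g hg => by
      rw [eval_refPoly]
      exact hB _ (affMap_mem_Icc hpq.le (Set.Ioo_subset_Icc_self (hG g hg).1))) s hs
  have hl : 0 < q - p := by linarith
  rw [derivative_refPoly, eval_mul, eval_C, eval_refPoly, abs_mul,
    abs_of_pos (by positivity)] at h
  rw [← mul_div_assoc, le_div_iff₀ hl]
  nlinarith

lemma exists_inverse_inequality (n j : ℕ) : ∃ C > 0, ∀ (Q : ℝ[X]) (p q B : ℝ),
    Q.natDegree ≤ n → p < q → (∀ t ∈ Set.Icc p q, |Q.eval t| ≤ B) →
      ∀ t ∈ Set.Icc p q, |(derivative^[j] Q).eval t| ≤ C * (B / (q - p) ^ j) := by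
  induction j with
  | zero => exact ⟨1, one_pos, fun Q p q B _ _ hB t ht => by simpa using hB t ht⟩
  | succ j ih =>
    obtain ⟨C, hC0, hC⟩ := ih
    obtain ⟨D, hD0, hD⟩ := exists_inverse_inequality_derivative n
    refine ⟨D * C, by positivity, fun Q p q B hQ hpq hB t ht => ?_⟩
    rw [Function.iterate_succ_apply']
    have hdeg : (derivative^[j] Q).natDegree ≤ n := by
      rw [natDegree_iterate_derivative_eq]; omega
    refine (hD _ p q _ hdeg hpq (hC Q p q B hQ hpq hB) t ht).trans_eq ?_
    rw [pow_succ]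
    have : q - p ≠ 0 := by linarith
    field_simp

end PolynomialBounds

section LocalEstimates

open Polynomial

lemma abs_sub_le_of_abs_deriv_le {f : ℝ → ℝ} {p q K : ℝ} (hf : Differentiable ℝ f)
    (hK : ∀ t ∈ Set.Icc p q, |deriv f t| ≤ K) {s t : ℝ} (hs : s ∈ Set.Icc p q)
    (ht : t ∈ Set.Icc p q) : |f t - f s| ≤ K * (q - p) := by
  have h := (convex_Icc p q).norm_image_sub_le_of_norm_deriv_le (fun y _ => hf y) hK hs ht
  have hK0 : 0 ≤ K := (abs_nonneg _).trans (hK s hs)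
  refine h.trans (mul_le_mul_of_nonneg_left ?_ hK0)
  rw [Real.norm_eq_abs, abs_le]
  constructor <;> linarith [hs.1, hs.2, ht.1, ht.2]

lemma exists_derivative_eq (T : ℝ[X]) : ∃ A : ℝ[X], derivative A = T ∧
    A.natDegree ≤ T.natDegree + 1 := by
  refine ⟨∑ i ∈ Finset.range (T.natDegree + 1), C (T.coeff i / (i + 1)) * X ^ (i + 1), ?_, ?_⟩
  · rw [derivative_sum]
    conv_rhs => rw [T.as_sum_range_C_mul_X_pow]
    refine Finset.sum_congr rfl fun i _ => ?_
    rw [derivative_C_mul_X_pow, Nat.add_sub_cancel]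
    congr 2
    push_cast
    field_simp
  · refine natDegree_sum_le_of_forall_le _ _ fun i hi => ?_
    refine (natDegree_C_mul_X_pow_le _ _).trans ?_
    have := Finset.mem_range.1 hi
    omega

lemma exists_taylor_polynomial (n : ℕ) {F : ℝ → ℝ} {p q K : ℝ} (hF : ContDiff ℝ (n + 1) F)
    (hpq : p ≤ q) (hK : ∀ t ∈ Set.Icc p q, |iteratedDeriv (n + 1) F t| ≤ K) :
    ∃ T : ℝ[X], T.natDegree ≤ n ∧ ∀ j ≤ n, ∀ t ∈ Set.Icc p q,
      |iteratedDeriv j F t - (derivative^[j] T).eval t| ≤ K * (q - p) ^ (n + 1 - j) := by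
  have hp : p ∈ Set.Icc p q := ⟨le_rfl, hpq⟩
  induction n generalizing F with
  | zero =>
    refine ⟨C (F p), by simp, fun j hj t ht => ?_⟩
    obtain rfl : j = 0 := by omega
    simp only [iteratedDeriv_zero, Function.iterate_zero_apply, eval_C]
    rw [pow_one]
    refine abs_sub_le_of_abs_deriv_le (hF.differentiable (by simp)) (fun y hy => ?_) hp ht
    simpa using hK y hy
  | succ n ih =>
    have hF' : ContDiff ℝ (n + 1) (deriv F) := by
      have : ContDiff ℝ ((n + 1 : ℕ∞) + 1) F := by exact_mod_cast hF
      exact_mod_cast (contDiff_succ_iff_deriv.1 this).2.2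
    obtain ⟨T', hT'd, hT'⟩ := ih hF' (fun t ht => by
      rw [← iteratedDeriv_succ']; exact hK t ht)
    obtain ⟨A, hA, hAd⟩ := exists_derivative_eq T'
    have hd : derivative (A + C (F p - A.eval p)) = T' := by simp [hA]
    refine ⟨A + C (F p - A.eval p), ?_, fun j hj t ht => ?_⟩
    · rw [natDegree_add_C]; omega
    · rcases j with _ | j
      · have hdiff : Differentiable ℝ F := hF.differentiable (by simp)
        have h := abs_sub_le_of_abs_deriv_le (p := p) (q := q) (K := K * (q - p) ^ (n + 1))
          (f := fun y => F y - (A + C (F p - A.eval p)).eval y)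
          (hdiff.sub (Polynomial.differentiable _)) (fun y hy => by
            rw [deriv_fun_sub (hdiff y) (Polynomial.differentiableAt _), Polynomial.deriv, hd]
            simpa using hT' 0 (by omega) y hy) hp ht
        simp only [eval_add, eval_C] at h
        simp only [iteratedDeriv_zero, Function.iterate_zero_apply, eval_add, eval_C]
        rw [show n + 1 + 1 - 0 = (n + 1) + 1 by omega, pow_succ, ← mul_assoc]
        refine le_trans (le_of_eq ?_) h
        congr 1; ring
      · rw [iteratedDeriv_succ', Function.iterate_succ_apply, hd]
        rw [show n + 1 + 1 - (j + 1) = n + 1 - j by omega]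
        exact hT' j (by omega) t ht

lemma integral_eval_affMap (p q s : ℝ) (T : ℝ[X]) :
    ∫ t in p..affMap p q s, T.eval t
      = (q - p) / 2 * ∫ t in (-1 : ℝ)..s, (refPoly p q T).eval t := by
  have h := intervalIntegral.smul_integral_comp_mul_add (a := -1) (b := s) (fun t => T.eval t)
    ((q - p) / 2) ((p + q) / 2)
  rw [smul_eq_mul] at h
  have h1 : ∀ t, T.eval ((q - p) / 2 * t + (p + q) / 2) = (refPoly p q T).eval t := by
    intro t; rw [eval_refPoly, affMap]; congr 1; ring
  simp only [h1] at h
  rw [h]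
  congr 1 <;> (try unfold affMap) <;> ring

/-- Integrals of functions vanishing at the Gauss points gain one order per derivative, up to the
degree `m` for which the reference functional is controlled by the Gauss values. -/
lemma abs_integral_le_of_vanishing {m : ℕ} {G : Finset ℝ}
    (hG : ∀ g ∈ G, g ∈ Set.Icc (-1 : ℝ) 1) {s C₀ : ℝ} (hs : s ∈ Set.Icc (-1 : ℝ) 1)
    (hC : ∀ (T : ℝ[X]) (δ : ℝ), T.natDegree ≤ m → (∀ g ∈ G, |T.eval g| ≤ δ) →
      |∫ t in (-1 : ℝ)..s, T.eval t| ≤ C₀ * δ)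
    {F : ℝ → ℝ} {p q K : ℝ} (hF : ContDiff ℝ (m + 1) F) (hpq : p ≤ q)
    (hK : ∀ t ∈ Set.Icc p q, |iteratedDeriv (m + 1) F t| ≤ K)
    (h0 : ∀ g ∈ G, F (affMap p q g) = 0) :
    |∫ t in p..affMap p q s, F t| ≤ (C₀ + 1) * (K * (q - p) ^ (m + 2)) := by
  obtain ⟨T, hTd, hT⟩ := exists_taylor_polynomial m hF hpq hK
  have hT0 : ∀ t ∈ Set.Icc p q, |F t - T.eval t| ≤ K * (q - p) ^ (m + 1) := fun t ht => by
    simpa using hT 0 (Nat.zero_le _) t ht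
  have hl : 0 ≤ q - p := by linarith
  have hK0 : 0 ≤ K := (abs_nonneg _).trans (hK p ⟨le_rfl, hpq⟩)
  have h1 := hC (refPoly p q T) (K * (q - p) ^ (m + 1)) ((natDegree_refPoly_le p q T).trans hTd)
    (fun g hg => by
      have := hT0 _ (affMap_mem_Icc hpq (hG g hg))
      rw [h0 g hg, zero_sub, abs_neg] at this
      rwa [eval_refPoly])
  have hmem := affMap_mem_Icc hpq hs
  have h2 := intervalIntegral.norm_integral_le_of_norm_le_const (a := p) (b := affMap p q s)
    (C := K * (q - p) ^ (m + 1)) (f := fun t => F t - T.eval t) (by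
      intro t ht
      rw [Set.uIoc_of_le hmem.1] at ht
      exact hT0 t ⟨ht.1.le, ht.2.trans hmem.2⟩)
  rw [intervalIntegral.integral_sub (hF.continuous.intervalIntegrable _ _)
    (T.continuous.intervalIntegrable _ _), Real.norm_eq_abs,
    abs_of_nonneg (show 0 ≤ affMap p q s - p by linarith [hmem.1]),
    integral_eval_affMap] at h2
  have h3 : |(q - p) / 2 * ∫ t in (-1 : ℝ)..s, (refPoly p q T).eval t|
      ≤ (q - p) * (C₀ * (K * (q - p) ^ (m + 1))) := by
    rw [abs_mul, abs_of_nonneg (by positivity)]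
    exact mul_le_mul (by linarith) h1 (abs_nonneg _) hl
  have h4 : K * (q - p) ^ (m + 1) * (affMap p q s - p) ≤ K * (q - p) ^ (m + 1) * (q - p) :=
    mul_le_mul_of_nonneg_left (by linarith [hmem.2]) (by positivity)
  have h5 := abs_add_le ((∫ t in p..affMap p q s, F t)
    - (q - p) / 2 * ∫ t in (-1 : ℝ)..s, (refPoly p q T).eval t)
    ((q - p) / 2 * ∫ t in (-1 : ℝ)..s, (refPoly p q T).eval t)
  rw [sub_add_cancel] at h5
  have h6 : (C₀ + 1) * (K * (q - p) ^ (m + 2)) = (q - p) * (C₀ * (K * (q - p) ^ (m + 1)))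
      + K * (q - p) ^ (m + 1) * (q - p) := by ring
  linarith

/-- A collocated residual is bounded by interpolation error plus the variation of its lower order
part. -/
lemma exists_residual_bound (m : ℕ) (G : Finset ℝ) (hGc : m + 1 ≤ G.card)
    (hG : ∀ g ∈ G, g ∈ Set.Icc (-1 : ℝ) 1) :
    ∃ C > 0, ∀ (F v : ℝ → ℝ) (R : ℝ[X]) (p q K V : ℝ), ContDiff ℝ (m + 1) F →
      Differentiable ℝ v → p < q → R.natDegree ≤ m →
      (∀ t ∈ Set.Icc p q, |iteratedDeriv (m + 1) F t| ≤ K) →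
      (∀ t ∈ Set.Icc p q, |deriv v t| ≤ V) →
      (∀ g ∈ G, R.eval (affMap p q g) - F (affMap p q g) + v (affMap p q g) = 0) →
      ∀ t ∈ Set.Icc p q, |R.eval t - F t + v t| ≤ C * (K * (q - p) ^ (m + 1) + V * (q - p)) := by
  obtain ⟨C, hC0, hC⟩ := exists_bound_of_nodes LinearMap.id (by omega) G hGc
  refine ⟨C + 1, by positivity, fun F v R p q K V hF hv hpq hR hK hV h0 t ht => ?_⟩
  obtain ⟨T, hTd, hT⟩ := exists_taylor_polynomial m hF hpq.le hK
  have hT0 : ∀ t ∈ Set.Icc p q, |F t - T.eval t| ≤ K * (q - p) ^ (m + 1) := fun t ht => by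
    simpa using hT 0 (Nat.zero_le _) t ht
  have hp : p ∈ Set.Icc p q := ⟨le_rfl, hpq.le⟩
  have hvar : ∀ t ∈ Set.Icc p q, |v t - v p| ≤ V * (q - p) := fun t ht =>
    abs_sub_le_of_abs_deriv_le hv hV hp ht
  have key : ∀ t ∈ Set.Icc p q, |(R - T + Polynomial.C (v p)).eval t|
      ≤ C * (K * (q - p) ^ (m + 1) + V * (q - p)) := by
    intro t ht
    obtain ⟨s, hs, rfl⟩ := exists_affMap_eq hpq ht
    rw [← eval_refPoly]
    refine hC _ _ (degree_lt_of_natDegree_le ((natDegree_refPoly_le _ _ _).trans ?_)) ?_ s hs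
    · rw [natDegree_add_C]
      exact (natDegree_sub_le _ _).trans (max_le hR hTd)
    · intro g hg
      rw [eval_refPoly, eval_add, eval_sub, eval_C]
      have hm := affMap_mem_Icc hpq.le (hG g hg)
      have h1 := abs_le.1 (hT0 _ hm)
      have h2 := abs_le.1 (hvar _ hm)
      have h3 := h0 g hg
      rw [abs_le]
      constructor <;> linarith [h1.1, h1.2, h2.1, h2.2]
  have h1 := abs_le.1 (hT0 _ ht)
  have h2 := abs_le.1 (hvar _ ht)
  have h3 := abs_le.1 (key _ ht)
  rw [eval_add, eval_sub, eval_C] at h3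
  rw [abs_le]
  constructor <;> linarith [h1.1, h1.2, h2.1, h2.2, h3.1, h3.2]

/-- Closeness of a polynomial to a smooth function passes to derivatives. -/
lemma exists_derivative_bound (m : ℕ) :
    ∃ C > 0, ∀ (F : ℝ → ℝ) (R : ℝ[X]) (p q K A : ℝ), ContDiff ℝ (m + 1) F → p < q →
      R.natDegree ≤ m → (∀ t ∈ Set.Icc p q, |iteratedDeriv (m + 1) F t| ≤ K) →
      (∀ t ∈ Set.Icc p q, |F t - R.eval t| ≤ A) →
      ∀ j ≤ m, ∀ t ∈ Set.Icc p q, |iteratedDeriv j F t - (derivative^[j] R).eval t|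
        ≤ C * ((K * (q - p) ^ (m + 1) + A) / (q - p) ^ j) := by
  choose C hC0 hC using exists_inverse_inequality m
  have hsum : ∀ j ≤ m, C j ≤ ∑ i ∈ Finset.range (m + 1), C i := fun j hj =>
    Finset.single_le_sum (f := C) (fun i _ => (hC0 i).le) (Finset.mem_range.2 (by omega))
  have hS0 : 0 ≤ ∑ i ∈ Finset.range (m + 1), C i := Finset.sum_nonneg fun i _ => (hC0 i).le
  refine ⟨∑ i ∈ Finset.range (m + 1), C i + 1, by positivity,
    fun F R p q K A hF hpq hR hK hA j hj t ht => ?_⟩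
  obtain ⟨T, hTd, hT⟩ := exists_taylor_polynomial m hF hpq.le hK
  have hl : 0 < q - p := by linarith
  have hK0 : 0 ≤ K := (abs_nonneg _).trans (hK p ⟨le_rfl, hpq.le⟩)
  have hA0 : 0 ≤ A := (abs_nonneg _).trans (hA p ⟨le_rfl, hpq.le⟩)
  have h1 := hC j (T - R) p q (K * (q - p) ^ (m + 1) + A)
    ((natDegree_sub_le _ _).trans (max_le hTd hR)) hpq (fun t ht => by
      have h1 := abs_le.1 (hA t ht)
      have h2 := hT 0 (Nat.zero_le _) t ht
      simp only [iteratedDeriv_zero, Function.iterate_zero_apply, Nat.sub_zero] at h2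
      have h2 := abs_le.1 h2
      rw [eval_sub, abs_le]
      constructor <;> linarith [h1.1, h1.2, h2.1, h2.2]) t ht
  have h2 := hT j hj t ht
  have h3 : K * (q - p) ^ (m + 1 - j) ≤ (K * (q - p) ^ (m + 1) + A) / (q - p) ^ j := by
    rw [le_div_iff₀ (by positivity), mul_assoc, ← pow_add, Nat.sub_add_cancel (by omega)]
    linarith
  have h4 : 0 ≤ (K * (q - p) ^ (m + 1) + A) / (q - p) ^ j := by positivity
  have h5 := mul_le_mul_of_nonneg_right (hsum j hj) h4
  rw [iterate_derivative_sub, eval_sub] at h1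
  have h1 := abs_le.1 h1
  have h2 := abs_le.1 h2
  rw [abs_le]
  constructor <;> linarith [h1.1, h1.2, h2.1, h2.2]

end LocalEstimates

section Stability

/-- The differential operator `-α e'' + β e' + γ e`. -/
noncomputable def diffOp (α β γ : ℝ) (e : ℝ → ℝ) (t : ℝ) : ℝ :=
  -α * iteratedDeriv 2 e t + β * deriv e t + γ * e t

/-- The boundary form of Green's identity for `diffOp`. -/
noncomputable def greenForm (α β : ℝ) (e ψ : ℝ → ℝ) (t : ℝ) : ℝ :=
  -α * (deriv e t * ψ t - e t * deriv ψ t) + β * (e t * ψ t)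

/-- `ψ` solves the adjoint homogeneous equation. -/
def IsAdjointSol (α β γ : ℝ) (ψ : ℝ → ℝ) : Prop :=
  ContDiff ℝ (⊤ : ℕ∞) ψ ∧ ∀ t, α * iteratedDeriv 2 ψ t + β * deriv ψ t - γ * ψ t = 0

lemma hasDerivAt_deriv_of_contDiff_two {e : ℝ → ℝ} (he : ContDiff ℝ 2 e) (t : ℝ) :
    HasDerivAt e (deriv e t) t ∧ HasDerivAt (deriv e) (iteratedDeriv 2 e t) t := by
  refine ⟨(he.differentiable (by norm_num) t).hasDerivAt, ?_⟩
  have h : Differentiable ℝ (iteratedDeriv 1 e) :=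
    he.differentiable_iteratedDeriv 1 (by norm_num)
  rw [iteratedDeriv_one] at h
  rw [iteratedDeriv_succ, iteratedDeriv_one]
  exact (h t).hasDerivAt

lemma continuous_diffOp {α β γ : ℝ} {e : ℝ → ℝ} (he : ContDiff ℝ 2 e) :
    Continuous (diffOp α β γ e) := by
  have h2 := he.continuous_iteratedDeriv 2 le_rfl
  have h1 := he.continuous_deriv (by norm_num)
  have h0 := he.continuous
  unfold diffOp
  fun_prop

lemma IsAdjointSol.contDiff {α β γ : ℝ} {ψ : ℝ → ℝ} (h : IsAdjointSol α β γ ψ) (n : ℕ) :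
    ContDiff ℝ n ψ := h.1.of_le (by exact_mod_cast le_top)

lemma IsAdjointSol.comp_sub {α β γ : ℝ} {ψ : ℝ → ℝ} (h : IsAdjointSol α β γ ψ) (y : ℝ) :
    IsAdjointSol α β γ (fun t => ψ (t - y)) := by
  refine ⟨h.1.comp (contDiff_id.sub contDiff_const), fun t => ?_⟩
  rw [iteratedDeriv_comp_sub_const, deriv_comp_sub_const]
  exact h.2 _

lemma integral_diffOp_mul {α β γ : ℝ} {e ψ : ℝ → ℝ} (he : ContDiff ℝ 2 e)
    (hψ : IsAdjointSol α β γ ψ) (p q : ℝ) :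
    ∫ t in p..q, diffOp α β γ e t * ψ t = greenForm α β e ψ q - greenForm α β e ψ p := by
  have hψ2 : ContDiff ℝ 2 ψ := hψ.contDiff 2
  apply integral_eq_sub_of_hasDerivAt
  · intro t _
    obtain ⟨h1, h2⟩ := hasDerivAt_deriv_of_contDiff_two he t
    obtain ⟨h3, h4⟩ := hasDerivAt_deriv_of_contDiff_two hψ2 t
    refine ((((h2.mul h3).sub (h1.mul h4)).const_mul (-α)).add
      ((h1.mul h3).const_mul β)).congr_deriv ?_
    unfold diffOp
    linear_combination e t * hψ.2 t
  · exact ((continuous_diffOp he).mul hψ2.continuous).intervalIntegrable _ _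

/-- The integral of the piecewise function `F j` on `[x j, x (j+1)]` against `ψ` from `x 0` up to a
point `y` of the element with index `i`. -/
noncomputable def moment (x : ℕ → ℝ) (F : ℕ → ℝ → ℝ) (ψ : ℝ → ℝ) (i : ℕ) (y : ℝ) : ℝ :=
  ∑ j ∈ Finset.range i, (∫ t in (x j)..(x (j + 1)), F j t * ψ t) + ∫ t in (x i)..y, F i t * ψ t

/-- A family of functions `e j`, glued in a `C¹` way at the interior nodes of a mesh and vanishing
at its ends. -/
structure IsGlued (N : ℕ) (x : ℕ → ℝ) (e : ℕ → ℝ → ℝ) : Prop where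
  one_le : 1 ≤ N
  mono : ∀ j < N, x j < x (j + 1)
  smooth : ∀ j < N, ContDiff ℝ 2 (e j)
  val : ∀ j, j + 1 < N → e j (x (j + 1)) = e (j + 1) (x (j + 1))
  der : ∀ j, j + 1 < N → deriv (e j) (x (j + 1)) = deriv (e (j + 1)) (x (j + 1))
  left : e 0 (x 0) = 0
  right : e (N - 1) (x N) = 0

lemma IsGlued.moment_eq {α β γ : ℝ} {N : ℕ} {x : ℕ → ℝ} {e : ℕ → ℝ → ℝ} (H : IsGlued N x e)
    {ψ : ℝ → ℝ} (hψ : IsAdjointSol α β γ ψ) (i : ℕ) (hi : i < N) (y : ℝ) :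
    moment x (fun j => diffOp α β γ (e j)) ψ i y
      = greenForm α β (e i) ψ y - greenForm α β (e 0) ψ (x 0) := by
  induction i generalizing y with
  | zero => simp [moment, integral_diffOp_mul (H.smooth 0 hi) hψ]
  | succ i ih =>
    have h := ih (by omega) (x (i + 1))
    have hg : greenForm α β (e i) ψ (x (i + 1)) = greenForm α β (e (i + 1)) ψ (x (i + 1)) := by
      rw [greenForm, greenForm, H.val i hi, H.der i hi]
    unfold moment at h ⊢
    rw [Finset.sum_range_succ, h, integral_diffOp_mul (H.smooth (i + 1) hi) hψ, hg]
    ring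

lemma mesh_le {N : ℕ} {x : ℕ → ℝ} (hx : ∀ j < N, x j < x (j + 1)) {i j : ℕ} (hij : i ≤ j)
    (hj : j ≤ N) : x i ≤ x j := by
  induction j, hij using Nat.le_induction with
  | base => exact le_rfl
  | succ j _ ih => exact (ih (by omega)).trans (hx j (by omega)).le

lemma abs_moment_le {x : ℕ → ℝ} {F : ℕ → ℝ → ℝ} {ψ : ℝ → ℝ} {i : ℕ} {y D : ℝ}
    (h : ∀ j < i, |∫ t in (x j)..(x (j + 1)), F j t * ψ t| ≤ D * (x (j + 1) - x j))
    (hy : |∫ t in (x i)..y, F i t * ψ t| ≤ D * (y - x i)) :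
    |moment x F ψ i y| ≤ D * (y - x 0) := by
  have h1 : |∑ j ∈ Finset.range i, ∫ t in (x j)..(x (j + 1)), F j t * ψ t| ≤ D * (x i - x 0) := by
    refine (Finset.abs_sum_le_sum_abs _ _).trans ?_
    refine (Finset.sum_le_sum fun j hj => h j (Finset.mem_range.1 hj)).trans_eq ?_
    rw [← Finset.mul_sum, Finset.sum_range_sub]
  refine (abs_add_le _ _).trans ?_
  linarith

/-- Two solutions of the adjoint equation allowing to recover the values and the derivatives of a
function from its residual. -/
structure IsDualPair (α β γ d : ℝ) (S E : ℝ → ℝ) : Prop where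
  solS : IsAdjointSol α β γ S
  solE : IsAdjointSol α β γ E
  S_zero : S 0 = 0
  deriv_S_zero : deriv S 0 = 1
  S_neg_ne : S (-d) ≠ 0
  E_zero : E 0 = 1

lemma exp_isAdjointSol {α β γ l : ℝ} (hl : α * l ^ 2 + β * l - γ = 0) :
    IsAdjointSol α β γ (fun t => Real.exp (l * t)) := by
  refine ⟨by fun_prop, fun t => ?_⟩
  have h1 : deriv (fun t => Real.exp (l * t)) = fun t => l * Real.exp (l * t) := by
    ext t
    have h := ((hasDerivAt_id t).const_mul l).exp.deriv
    simp only [id, mul_one] at h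
    rw [h, mul_comm]
  rw [iteratedDeriv_succ, iteratedDeriv_one, h1, deriv_const_mul_field, h1]
  linear_combination Real.exp (l * t) * hl

lemma exists_isDualPair {α β γ d : ℝ} (hα : 0 < α) (hγ : 0 ≤ γ) (hd : 0 < d) :
    ∃ S E, IsDualPair α β γ d S E := by
  have hD : 0 ≤ β ^ 2 + 4 * α * γ := by positivity
  set r := Real.sqrt (β ^ 2 + 4 * α * γ) with hr
  have hr2 : r ^ 2 = β ^ 2 + 4 * α * γ := Real.sq_sqrt hD
  have hroot : ∀ σ : ℝ, σ ^ 2 = r ^ 2 →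
      α * ((-β + σ) / (2 * α)) ^ 2 + β * ((-β + σ) / (2 * α)) - γ = 0 := by
    intro σ hσ
    field_simp
    linear_combination hσ + hr2
  set l₁ := (-β + r) / (2 * α) with hl₁
  set l₂ := (-β + -r) / (2 * α) with hl₂
  have h₁ := hroot r rfl
  have h₂ := hroot (-r) (by ring)
  have hE := exp_isAdjointSol h₁
  have hE₂ := exp_isAdjointSol h₂
  rw [← hl₁] at hE h₁
  rw [← hl₂] at hE₂ h₂
  have hder : ∀ l t : ℝ, HasDerivAt (fun t => Real.exp (l * t)) (l * Real.exp (l * t)) t := by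
    intro l t
    have h := ((hasDerivAt_id t).const_mul l).exp
    simp only [id, mul_one] at h
    rwa [mul_comm] at h
  rcases eq_or_ne r 0 with h0 | h0
  · have hdS : deriv (fun t => t * Real.exp (l₁ * t))
        = fun t => Real.exp (l₁ * t) + t * (l₁ * Real.exp (l₁ * t)) := by
      ext t
      refine ((hasDerivAt_id t).mul (hder l₁ t)).deriv.trans ?_
      simp
    have hll : 2 * α * l₁ + β = 0 := by
      rw [hl₁, h0]; field_simp; ring
    refine ⟨fun t => t * Real.exp (l₁ * t), _, ⟨by fun_prop, fun t => ?_⟩, hE, by simp, ?_, ?_,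
      by simp⟩
    · have h2 : deriv (fun t => Real.exp (l₁ * t) + t * (l₁ * Real.exp (l₁ * t))) t
          = 2 * l₁ * Real.exp (l₁ * t) + t * l₁ ^ 2 * Real.exp (l₁ * t) := by
        have := ((hder l₁ t).add ((hasDerivAt_id t).mul ((hder l₁ t).const_mul l₁))).deriv
        refine Eq.trans this ?_
        simp only [id]
        ring
      rw [iteratedDeriv_succ, iteratedDeriv_one, hdS, h2]
      linear_combination t * Real.exp (l₁ * t) * h₁ + Real.exp (l₁ * t) * hll
    · rw [hdS]; simp
    · have := Real.exp_pos (l₁ * -d)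
      simp only [ne_eq, mul_eq_zero, neg_eq_zero, not_or]
      exact ⟨hd.ne', this.ne'⟩
  · have hne : l₁ - l₂ ≠ 0 := by
      rw [hl₁, hl₂, ← sub_div]
      apply div_ne_zero _ (by positivity)
      intro h; apply h0; linarith
    have hdS : deriv (fun t => (l₁ - l₂)⁻¹ * (Real.exp (l₁ * t) - Real.exp (l₂ * t)))
        = fun t => (l₁ - l₂)⁻¹ * (l₁ * Real.exp (l₁ * t) - l₂ * Real.exp (l₂ * t)) := by
      ext t
      exact (((hder l₁ t).sub (hder l₂ t)).const_mul _).deriv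
    refine ⟨fun t => (l₁ - l₂)⁻¹ * (Real.exp (l₁ * t) - Real.exp (l₂ * t)), _,
      ⟨by fun_prop, fun t => ?_⟩, hE, by simp, ?_, ?_, by simp⟩
    · have h2 : deriv (fun t => (l₁ - l₂)⁻¹ * (l₁ * Real.exp (l₁ * t) - l₂ * Real.exp (l₂ * t))) t
          = (l₁ - l₂)⁻¹ * (l₁ * (l₁ * Real.exp (l₁ * t)) - l₂ * (l₂ * Real.exp (l₂ * t))) :=
        ((((hder l₁ t).const_mul l₁).sub ((hder l₂ t).const_mul l₂)).const_mul _).deriv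
      rw [iteratedDeriv_succ, iteratedDeriv_one, hdS, h2]
      linear_combination (l₁ - l₂)⁻¹ * (Real.exp (l₁ * t) * h₁ - Real.exp (l₂ * t) * h₂)
    · rw [hdS]
      simp [inv_mul_cancel₀ hne]
    · refine mul_ne_zero (inv_ne_zero hne) ?_
      rw [sub_ne_zero]
      intro h
      have := Real.exp_injective h
      apply hne
      have h3 : (l₁ - l₂) * d = 0 := by linarith
      exact (mul_eq_zero.1 h3).resolve_right hd.ne'

lemma exists_bound_iteratedDeriv {f : ℝ → ℝ} (hf : ContDiff ℝ (⊤ : ℕ∞) f) (n : ℕ) (p q : ℝ) :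
    ∃ B > 0, ∀ j ≤ n, ∀ t ∈ Set.Icc p q, |iteratedDeriv j f t| ≤ B := by
  have hb : ∀ j : ℕ, ∃ B > 0, ∀ t ∈ Set.Icc p q, |iteratedDeriv j f t| ≤ B := by
    intro j
    obtain ⟨B, hB⟩ := (isCompact_Icc (a := p) (b := q)).exists_bound_of_continuousOn
      (hf.continuous_iteratedDeriv j (by exact_mod_cast le_top)).continuousOn
    exact ⟨max B 1, by positivity, fun s hs => (hB s hs).trans (le_max_left _ _)⟩
  choose B hB0 hB using hb
  refine ⟨∑ i ∈ Finset.range (n + 1), B i, ?_, fun j hj t ht => (hB j t ht).trans ?_⟩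
  · exact Finset.sum_pos (fun i _ => hB0 i) ⟨0, by simp⟩
  · exact Finset.single_le_sum (f := B) (fun i _ => (hB0 i).le) (Finset.mem_range.2 (by omega))

lemma exists_stability_bound {α β γ d : ℝ} (hα : 0 < α) {S E : ℝ → ℝ}
    (hSE : IsDualPair α β γ d S E) :
    ∃ C > 0, ∀ (N : ℕ) (x : ℕ → ℝ) (e : ℕ → ℝ → ℝ) (δ : ℝ), IsGlued N x e → x N - x 0 = d →
      |moment x (fun j => diffOp α β γ (e j)) (fun t => S (t - x N)) (N - 1) (x N)| ≤ δ →
      ∀ i < N, ∀ y ∈ Set.Icc (x i) (x (i + 1)),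
        |moment x (fun j => diffOp α β γ (e j)) (fun t => S (t - y)) i y| ≤ δ →
        |moment x (fun j => diffOp α β γ (e j)) (fun t => E (t - y)) i y| ≤ δ →
        |e i y| ≤ C * δ ∧ |deriv (e i) y| ≤ C * δ := by
  obtain ⟨B₁, hB₁0, hB₁⟩ := exists_bound_iteratedDeriv hSE.solS.1 0 (-d) 0
  obtain ⟨B₂, hB₂0, hB₂⟩ := exists_bound_iteratedDeriv hSE.solE.1 0 (-d) 0
  set σ := |S (-d)|⁻¹ with hσ
  have hσ0 : 0 < σ := inv_pos.2 (abs_pos.2 hSE.S_neg_ne)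
  set κ := |α * deriv E 0 + β| with hκ
  have hκ0 : 0 ≤ κ := abs_nonneg _
  refine ⟨(1 + σ * (B₁ + B₂)) / α * (1 + κ / α) + (1 + σ * (B₁ + B₂)) / α, by positivity,
    fun N x e δ H hd hb i hi y hy hS hE => ?_⟩
  have hN := H.one_le
  have hδ0 : 0 ≤ δ := (abs_nonneg _).trans hb
  rw [H.moment_eq (hSE.solS.comp_sub _) _ (by omega)] at hb
  rw [H.moment_eq (hSE.solS.comp_sub _) _ hi] at hS
  rw [H.moment_eq (hSE.solE.comp_sub _) _ hi] at hE
  simp only [greenForm, deriv_comp_sub_const, sub_self, hSE.S_zero, hSE.deriv_S_zero, hSE.E_zero,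
    H.left, H.right] at hb hS hE
  rw [show x 0 - x N = -d by linarith] at hb
  have hz0 : x 0 ≤ x i := mesh_le H.mono (Nat.zero_le _) hi.le
  have hzN : x (i + 1) ≤ x N := mesh_le H.mono (by omega) le_rfl
  have hmem : x 0 - y ∈ Set.Icc (-d) 0 := ⟨by linarith [hy.2], by linarith [hy.1]⟩
  have hS1 : |S (x 0 - y)| ≤ B₁ := by simpa using hB₁ 0 le_rfl _ hmem
  have hE1 : |E (x 0 - y)| ≤ B₂ := by simpa using hB₂ 0 le_rfl _ hmem
  set z := α * deriv (e 0) (x 0) with hz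
  have hS' : |α * e i y + z * S (x 0 - y)| ≤ δ := by
    refine le_trans (le_of_eq ?_) hS
    congr 1; rw [hz]; ring
  have hE' : |-(α * deriv (e i) y) + (α * deriv E 0 + β) * e i y + z * E (x 0 - y)| ≤ δ := by
    refine le_trans (le_of_eq ?_) hE
    congr 1; rw [hz]; ring
  clear hS hE
  have hzb : |z| ≤ δ * σ := by
    rw [hσ, ← div_eq_mul_inv, le_div_iff₀ (abs_pos.2 hSE.S_neg_ne), ← abs_mul]
    refine le_trans (le_of_eq ?_) hb
    congr 1; rw [hz]; ring
  have hzS : |z * S (x 0 - y)| ≤ δ * σ * B₁ := by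
    rw [abs_mul]; exact mul_le_mul hzb hS1 (abs_nonneg _) (by positivity)
  have hzE : |z * E (x 0 - y)| ≤ δ * σ * B₂ := by
    rw [abs_mul]; exact mul_le_mul hzb hE1 (abs_nonneg _) (by positivity)
  set Q := (1 + σ * (B₁ + B₂)) / α with hQ
  have hQα : α * Q = 1 + σ * (B₁ + B₂) := by rw [hQ]; field_simp
  have hQ0 : 0 < Q := by positivity
  have hp1 : 0 ≤ δ * σ * B₁ := by positivity
  have hp2 : 0 ≤ δ * σ * B₂ := by positivity
  have he : |e i y| ≤ Q * δ := by
    have h1 : α * |e i y| ≤ δ + δ * σ * B₁ := by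
      rw [show ∀ r : ℝ, α * |r| = |α * r| from fun r => by rw [abs_mul, abs_of_pos hα]]
      have h2 := abs_le.1 hS'
      have h3 := abs_le.1 hzS
      rw [abs_le]
      constructor <;> linarith [h2.1, h2.2, h3.1, h3.2]
    refine le_of_mul_le_mul_left ?_ hα
    calc α * |e i y| ≤ δ + δ * σ * B₁ := h1
      _ ≤ (1 + σ * (B₁ + B₂)) * δ := by linarith
      _ = α * (Q * δ) := by rw [← hQα]; ring
  have he' : |deriv (e i) y| ≤ Q * (1 + κ / α) * δ := by
    have h0 : |(α * deriv E 0 + β) * e i y| ≤ κ * (Q * δ) := by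
      rw [abs_mul]; exact mul_le_mul_of_nonneg_left he hκ0
    have h1 : α * |deriv (e i) y| ≤ δ + δ * σ * B₂ + κ * (Q * δ) := by
      rw [show ∀ r : ℝ, α * |r| = |α * r| from fun r => by rw [abs_mul, abs_of_pos hα]]
      have h2 := abs_le.1 hE'
      have h3 := abs_le.1 hzE
      have h4 := abs_le.1 h0
      rw [abs_le]
      constructor <;> linarith [h2.1, h2.2, h3.1, h3.2, h4.1, h4.2]
    refine le_of_mul_le_mul_left ?_ hα
    calc α * |deriv (e i) y| ≤ δ + δ * σ * B₂ + κ * (Q * δ) := h1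
      _ ≤ (1 + σ * (B₁ + B₂)) * δ + κ * (Q * δ) := by linarith
      _ = α * (Q * (1 + κ / α) * δ) := by rw [← hQα]; field_simp
  have hp3 : 0 ≤ Q * (1 + κ / α) * δ := by positivity
  have hp4 : 0 ≤ Q * δ := by positivity
  constructor <;> linarith

end Stability

section Collocation

open Polynomial

lemma contDiff_iteratedDeriv {f : ℝ → ℝ} {n i r : ℕ} (hf : ContDiff ℝ r f) (h : n + i ≤ r) :
    ContDiff ℝ n (iteratedDeriv i f) := by
  rw [iteratedDeriv_eq_iterate]
  apply ContDiff.iterate_deriv'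
  exact hf.of_le (by exact_mod_cast h)

lemma iteratedDeriv_iteratedDeriv_eq (f : ℝ → ℝ) (i j : ℕ) :
    iteratedDeriv i (iteratedDeriv j f) = iteratedDeriv (i + j) f := by
  simp only [iteratedDeriv_eq_iterate, Function.iterate_add_apply]

lemma abs_iteratedDeriv_mul_le {f g : ℝ → ℝ} {n : ℕ} {t A B : ℝ} (hf : ContDiff ℝ n f)
    (hg : ContDiff ℝ n g) (hA : ∀ i ≤ n, |iteratedDeriv i f t| ≤ A)
    (hB : ∀ i ≤ n, |iteratedDeriv i g t| ≤ B) :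
    |iteratedDeriv n (fun y => f y * g y) t| ≤ 2 ^ n * (A * B) := by
  have h := norm_iteratedFDeriv_mul_le (n := n) (N := n) hf hg t le_rfl
  simp only [norm_iteratedFDeriv_eq_norm_iteratedDeriv, Real.norm_eq_abs] at h
  have hA0 : 0 ≤ A := (abs_nonneg _).trans (hA 0 (Nat.zero_le _))
  refine h.trans ?_
  calc _ ≤ ∑ i ∈ Finset.range (n + 1), (n.choose i : ℝ) * (A * B) := by
        refine Finset.sum_le_sum fun i hi => ?_
        rw [mul_assoc]
        have hi' : i ≤ n := by have := Finset.mem_range.1 hi; omega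
        exact mul_le_mul_of_nonneg_left
          (mul_le_mul (hA i hi') (hB _ (Nat.sub_le _ _)) (abs_nonneg _) hA0) (Nat.cast_nonneg _)
    _ = 2 ^ n * (A * B) := by
        rw [← Finset.sum_mul]
        congr 1
        exact_mod_cast Nat.sum_range_choose n

lemma contDiff_diffOp {α β γ : ℝ} {e : ℝ → ℝ} {n r : ℕ} (he : ContDiff ℝ r e) (h : n + 2 ≤ r) :
    ContDiff ℝ n (diffOp α β γ e) := by
  have h2 := contDiff_iteratedDeriv (n := n) (i := 2) he h
  have h1 := contDiff_iteratedDeriv (n := n) (i := 1) he (by omega)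
  have h0 := contDiff_iteratedDeriv (n := n) (i := 0) he (by omega)
  rw [iteratedDeriv_one] at h1
  rw [iteratedDeriv_zero] at h0
  exact ((contDiff_const.mul h2).add (contDiff_const.mul h1)).add (contDiff_const.mul h0)

lemma iteratedDeriv_diffOp {α β γ : ℝ} {e : ℝ → ℝ} {n r : ℕ} (he : ContDiff ℝ r e)
    (h : n + 2 ≤ r) (t : ℝ) : iteratedDeriv n (diffOp α β γ e) t
      = -α * iteratedDeriv (n + 2) e t + β * iteratedDeriv (n + 1) e t
        + γ * iteratedDeriv n e t := by
  have h2 := contDiff_iteratedDeriv (n := n) (i := 2) he h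
  have h1 := contDiff_iteratedDeriv (n := n) (i := 1) he (by omega)
  have h0 := contDiff_iteratedDeriv (n := n) (i := 0) he (by omega)
  have hfun : diffOp α β γ e = ((fun t => -α * iteratedDeriv 2 e t)
      + fun t => β * iteratedDeriv 1 e t) + fun t => γ * iteratedDeriv 0 e t := by
    ext t
    simp [diffOp]
  rw [hfun, iteratedDeriv_add, iteratedDeriv_add, iteratedDeriv_const_mul_field,
    iteratedDeriv_const_mul_field, iteratedDeriv_const_mul_field, iteratedDeriv_iteratedDeriv_eq,
    iteratedDeriv_iteratedDeriv_eq, iteratedDeriv_iteratedDeriv_eq, add_zero]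
  · exact (contDiff_const.mul h2).contDiffAt
  · exact (contDiff_const.mul h1).contDiffAt
  · exact ((contDiff_const.mul h2).add (contDiff_const.mul h1)).contDiffAt
  · exact (contDiff_const.mul h0).contDiffAt

lemma abs_iteratedDeriv_diffOp_le {α β γ : ℝ} {e : ℝ → ℝ} {n r : ℕ} {K t : ℝ}
    (he : ContDiff ℝ r e) (h : n + 2 ≤ r) (hK : ∀ i ≤ r, |iteratedDeriv i e t| ≤ K) :
    |iteratedDeriv n (diffOp α β γ e) t| ≤ (|α| + |β| + |γ|) * K := by
  rw [iteratedDeriv_diffOp he h]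
  refine (abs_add_three _ _ _).trans ?_
  rw [abs_mul, abs_mul, abs_mul, abs_neg]
  have h1 := mul_le_mul_of_nonneg_left (hK (n + 2) (by omega)) (abs_nonneg α)
  have h2 := mul_le_mul_of_nonneg_left (hK (n + 1) (by omega)) (abs_nonneg β)
  have h3 := mul_le_mul_of_nonneg_left (hK n (by omega)) (abs_nonneg γ)
  linarith

lemma abs_integral_mul_le {F ψ : ℝ → ℝ} {p q A B : ℝ} (hpq : p ≤ q)
    (hF : ∀ t ∈ Set.Icc p q, |F t| ≤ A) (hψ : ∀ t ∈ Set.Icc p q, |ψ t| ≤ B) :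
    |∫ t in p..q, F t * ψ t| ≤ A * B * (q - p) := by
  have hA0 : 0 ≤ A := (abs_nonneg _).trans (hF p ⟨le_rfl, hpq⟩)
  have h := intervalIntegral.norm_integral_le_of_norm_le_const (a := p) (b := q) (C := A * B)
    (f := fun t => F t * ψ t) (by
      intro t ht
      rw [Set.uIoc_of_le hpq] at ht
      have ht' : t ∈ Set.Icc p q := ⟨ht.1.le, ht.2⟩
      rw [Real.norm_eq_abs, abs_mul]
      exact mul_le_mul (hF t ht') (hψ t ht') (abs_nonneg _) hA0)
  rwa [Real.norm_eq_abs, abs_of_nonneg (sub_nonneg.2 hpq)] at h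

/-- Uniform stability of the two point boundary value problem. -/
lemma exists_sup_stability_bound {α β γ d : ℝ} (hα : 0 < α) (hγ : 0 ≤ γ) (hd : 0 < d) :
    ∃ C > 0, ∀ (N : ℕ) (x : ℕ → ℝ) (e : ℕ → ℝ → ℝ) (A : ℝ), IsGlued N x e → x N - x 0 = d →
      (∀ j < N, ∀ t ∈ Set.Icc (x j) (x (j + 1)), |diffOp α β γ (e j) t| ≤ A) →
      ∀ i < N, ∀ y ∈ Set.Icc (x i) (x (i + 1)), ∀ r ≤ 2, |iteratedDeriv r (e i) y| ≤ C * A := by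
  obtain ⟨S, E, hSE⟩ := exists_isDualPair (β := β) hα hγ hd
  obtain ⟨C, hC0, hC⟩ := exists_stability_bound hα hSE
  obtain ⟨B₁, hB₁0, hB₁⟩ := exists_bound_iteratedDeriv hSE.solS.1 0 (-d) 0
  obtain ⟨B₂, hB₂0, hB₂⟩ := exists_bound_iteratedDeriv hSE.solE.1 0 (-d) 0
  set D := C * ((B₁ + B₂) * d) with hD
  have hD0 : 0 < D := by positivity
  refine ⟨D + (1 + |β| * D + γ * D) / α, by positivity, fun N x e A H hl hA i hi y hy => ?_⟩
  have hN := H.one_le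
  have hx0 : x 0 ∈ Set.Icc (x 0) (x (0 + 1)) := ⟨le_rfl, (H.mono 0 (by omega)).le⟩
  have hA0 : 0 ≤ A := (abs_nonneg _).trans (hA 0 (by omega) _ hx0)
  have hmom : ∀ ψ : ℝ → ℝ, (∀ t ∈ Set.Icc (-d) 0, |ψ t| ≤ B₁ + B₂) → ∀ i < N,
      ∀ y ∈ Set.Icc (x i) (x (i + 1)),
      |moment x (fun j => diffOp α β γ (e j)) (fun t => ψ (t - y)) i y| ≤ A * (B₁ + B₂) * d := by
    intro ψ hψ i hi y hy
    have hyN : y ≤ x N := hy.2.trans (mesh_le H.mono (by omega) le_rfl)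
    have hy0 : x i ≤ y := hy.1
    refine (abs_moment_le (D := A * (B₁ + B₂)) (fun j hj => ?_) ?_).trans ?_
    · refine abs_integral_mul_le (H.mono j (by omega)).le (hA j (by omega)) fun t ht => ?_
      have h1 : x 0 ≤ x j := mesh_le H.mono (by omega) (by omega)
      have h2 : x (j + 1) ≤ x i := mesh_le H.mono (by omega) (by omega)
      exact hψ _ ⟨by linarith [ht.1], by linarith [ht.2]⟩
    · refine abs_integral_mul_le hy.1 (fun t ht => hA i hi t ⟨ht.1, ht.2.trans hy.2⟩)
        fun t ht => ?_
      have h1 : x 0 ≤ x i := mesh_le H.mono (by omega) (by omega)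
      exact hψ _ ⟨by linarith [ht.1], by linarith [ht.2]⟩
    · exact mul_le_mul_of_nonneg_left (by linarith) (by positivity)
  have hS : ∀ t ∈ Set.Icc (-d) 0, |S t| ≤ B₁ + B₂ := fun t ht => by
    have := hB₁ 0 le_rfl t ht
    rw [iteratedDeriv_zero] at this
    linarith
  have hE : ∀ t ∈ Set.Icc (-d) 0, |E t| ≤ B₁ + B₂ := fun t ht => by
    have := hB₂ 0 le_rfl t ht
    rw [iteratedDeriv_zero] at this
    linarith
  have hb := hmom S hS (N - 1) (by omega) (x N) (by
    have := H.mono (N - 1) (by omega)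
    rw [Nat.sub_add_cancel hN] at this ⊢
    exact ⟨this.le, le_rfl⟩)
  obtain ⟨h0, h1⟩ := hC N x e _ H hl hb i hi y hy (hmom S hS i hi y hy) (hmom E hE i hi y hy)
  rw [show C * (A * (B₁ + B₂) * d) = D * A by rw [hD]; ring] at h0 h1
  have hpos : 0 ≤ (1 + |β| * D + γ * D) / α * A := by positivity
  intro r hr
  interval_cases r
  · rw [iteratedDeriv_zero]; linarith
  · rw [iteratedDeriv_one]; linarith
  · have h2 : α * |iteratedDeriv 2 (e i) y| ≤ (1 + |β| * D + γ * D) * A := by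
      have h3 : α * iteratedDeriv 2 (e i) y
          = -diffOp α β γ (e i) y + β * deriv (e i) y + γ * e i y := by
        rw [diffOp]; ring
      rw [show ∀ r : ℝ, α * |r| = |α * r| from fun r => by rw [abs_mul, abs_of_pos hα], h3]
      refine (abs_add_three _ _ _).trans ?_
      rw [abs_neg, abs_mul, abs_mul, abs_of_nonneg hγ]
      have h4 := mul_le_mul_of_nonneg_left h1 (abs_nonneg β)
      have h5 := mul_le_mul_of_nonneg_left h0 hγ
      have h6 := hA i hi y hy
      linarith
    have h3 : |iteratedDeriv 2 (e i) y| ≤ (1 + |β| * D + γ * D) / α * A := by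
      rw [div_mul_eq_mul_div, le_div_iff₀ hα]
      linarith
    have : 0 ≤ D * A := by positivity
    linarith

/-- The error of a piecewise polynomial approximation on the element with index `j`. -/
noncomputable def pieceError (u : ℝ → ℝ) (P : ℕ → ℝ[X]) (j : ℕ) (t : ℝ) : ℝ :=
  u t - (P j).eval t

/-- Gauss collocation for elements of degree `m + 2` on a quasi-uniform mesh, phrased through the
error; the elements are indexed from zero. -/
structure IsCollocation (m : ℕ) (α β γ d c : ℝ) (G : Finset ℝ) (N : ℕ) (x : ℕ → ℝ) (h M : ℝ)
    (u : ℝ → ℝ) (P : ℕ → ℝ[X]) : Prop where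
  glued : IsGlued N x (pieceError u P)
  smooth : ContDiff ℝ (2 * m + 4 : ℕ) u
  length : x N - x 0 = d
  le_h : ∀ j < N, x (j + 1) - x j ≤ h
  quasi : ∀ j < N, h ≤ c * (x (j + 1) - x j)
  deg : ∀ j < N, (P j).natDegree ≤ m + 2
  gauss : ∀ j < N, ∀ g ∈ G, diffOp α β γ (pieceError u P j) (affMap (x j) (x (j + 1)) g) = 0
  bound : ∀ i ≤ 2 * m + 4, ∀ y ∈ Set.Icc (x 0) (x N), |iteratedDeriv i u y| ≤ M

lemma contDiff_polynomial_eval (p : ℝ[X]) (n : ℕ) : ContDiff ℝ n (fun t => p.eval t) := by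
  simpa only [coe_aeval_eq_eval] using p.contDiff_aeval (𝕜 := ℝ) n

lemma contDiff_pieceError {u : ℝ → ℝ} {n : ℕ} (hu : ContDiff ℝ n u) (P : ℕ → ℝ[X]) (j : ℕ) :
    ContDiff ℝ n (pieceError u P j) := hu.sub (contDiff_polynomial_eval _ _)

lemma iteratedDeriv_pieceError {u : ℝ → ℝ} {n : ℕ} (hu : ContDiff ℝ n u) (P : ℕ → ℝ[X]) (j : ℕ)
    {i : ℕ} (hi : i ≤ n) (t : ℝ) : iteratedDeriv i (pieceError u P j) t
      = iteratedDeriv i u t - (derivative^[i] (P j)).eval t := by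
  have h : pieceError u P j = u - fun t => (P j).eval t := rfl
  rw [h, iteratedDeriv_sub (hu.of_le (by exact_mod_cast hi)).contDiffAt
      (contDiff_polynomial_eval _ _).contDiffAt,
    iteratedDeriv_polynomial_eval]

section

variable {m N : ℕ} {α β γ d c h M : ℝ} {G : Finset ℝ} {x : ℕ → ℝ} {u : ℝ → ℝ} {P : ℕ → ℝ[X]}

lemma IsCollocation.mem_Icc (H : IsCollocation m α β γ d c G N x h M u P) {j : ℕ} (hj : j < N)
    {t : ℝ} (ht : t ∈ Set.Icc (x j) (x (j + 1))) : t ∈ Set.Icc (x 0) (x N) :=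
  ⟨(mesh_le H.glued.mono (by omega) (by omega)).trans ht.1,
    ht.2.trans (mesh_le H.glued.mono (by omega) le_rfl)⟩

lemma IsCollocation.M_nonneg (H : IsCollocation m α β γ d c G N x h M u P) : 0 ≤ M :=
  (abs_nonneg _).trans (H.bound 0 (by omega) (x 0)
    ⟨le_rfl, mesh_le H.glued.mono (by omega) le_rfl⟩)

lemma IsCollocation.h_pos (H : IsCollocation m α β γ d c G N x h M u P) : 0 < h := by
  have hN := H.glued.one_le
  have h1 := H.glued.mono 0 (by omega)
  have h2 := H.le_h 0 (by omega)
  linarith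

end

/-- On fine meshes the error is of order `m + 1` in `W^{2,∞}`. -/
lemma exists_second_order_bound (m : ℕ) {α β γ d : ℝ} (c : ℝ) (hα : 0 < α) (hγ : 0 ≤ γ)
    (hd : 0 < d) (G : Finset ℝ) (hGc : m + 1 ≤ G.card) (hG : ∀ g ∈ G, g ∈ Set.Icc (-1 : ℝ) 1) :
    ∃ C > 0, ∃ h₀ > 0, ∀ (N : ℕ) (x : ℕ → ℝ) (h M : ℝ) (u : ℝ → ℝ) (P : ℕ → ℝ[X]),
      IsCollocation m α β γ d c G N x h M u P → h ≤ h₀ → ∀ j < N,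
        ∀ t ∈ Set.Icc (x j) (x (j + 1)), ∀ r ≤ 2,
          |iteratedDeriv r (pieceError u P j) t| ≤ C * (h ^ (m + 1) * M) := by
  obtain ⟨C₁, hC₁0, hC₁⟩ := exists_sup_stability_bound (β := β) hα hγ hd
  obtain ⟨C₂, hC₂0, hC₂⟩ := exists_residual_bound m G hGc hG
  set κ := (|β| + γ) * C₁ with hκ
  have hκ0 : 0 ≤ κ := by positivity
  refine ⟨C₁ * (2 * C₂ * α), by positivity, 1 / (2 * C₂ * (κ + 1)), by positivity,
    fun N x h M u P H hh => ?_⟩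
  have hu := H.smooth
  have hh0 := H.h_pos
  have hM0 := H.M_nonneg
  have hcont : ∀ j, Continuous (diffOp α β γ (pieceError u P j)) := fun j =>
    continuous_diffOp ((contDiff_pieceError hu P j).of_le (by norm_cast; omega))
  have hmax : ∀ j < N, ∃ t ∈ Set.Icc (x j) (x (j + 1)), ∀ y ∈ Set.Icc (x j) (x (j + 1)),
      |diffOp α β γ (pieceError u P j) y| ≤ |diffOp α β γ (pieceError u P j) t| := fun j hj =>
    isCompact_Icc.exists_isMaxOn ⟨x j, le_rfl, (H.glued.mono j hj).le⟩
      (hcont j).abs.continuousOn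
  choose! T hT hTmax using hmax
  obtain ⟨i, hi, himax⟩ := Finset.exists_max_image (Finset.range N)
    (fun j => |diffOp α β γ (pieceError u P j) (T j)|) ⟨0, Finset.mem_range.2 H.glued.one_le⟩
  have hi := Finset.mem_range.1 hi
  set A := |diffOp α β γ (pieceError u P i) (T i)| with hAdef
  have hA : ∀ j < N, ∀ t ∈ Set.Icc (x j) (x (j + 1)), |diffOp α β γ (pieceError u P j) t| ≤ A :=
    fun j hj t ht => (hTmax j hj t ht).trans (himax j (Finset.mem_range.2 hj))
  have hA0 : 0 ≤ A := abs_nonneg _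
  have hstab := hC₁ N x (pieceError u P) A H.glued H.length hA
  have hAle : A ≤ 2 * C₂ * α * (h ^ (m + 1) * M) := by
    have hl0 : 0 < x (i + 1) - x i := sub_pos.2 (H.glued.mono i hi)
    have he2 : ContDiff ℝ 2 (pieceError u P i) := H.glued.smooth i hi
    have hv : ∀ t, HasDerivAt (fun t => β * deriv (pieceError u P i) t + γ * pieceError u P i t)
        (β * iteratedDeriv 2 (pieceError u P i) t + γ * deriv (pieceError u P i) t) t := fun t =>
      ((hasDerivAt_deriv_of_contDiff_two he2 t).2.const_mul β).add
        ((hasDerivAt_deriv_of_contDiff_two he2 t).1.const_mul γ)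
    have hform : ∀ t, (Polynomial.C α * derivative^[2] (P i)).eval t - α * iteratedDeriv 2 u t
        + (β * deriv (pieceError u P i) t + γ * pieceError u P i t)
        = diffOp α β γ (pieceError u P i) t := fun t => by
      rw [diffOp, iteratedDeriv_pieceError hu P i (by omega), eval_mul, eval_C]
      ring
    have hF : ContDiff ℝ (m + 1 : ℕ) (fun t => α * iteratedDeriv 2 u t) :=
      contDiff_const.mul (contDiff_iteratedDeriv hu (by omega))
    have h1 := hC₂ (fun t => α * iteratedDeriv 2 u t)
      (fun t => β * deriv (pieceError u P i) t + γ * pieceError u P i t)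
      (Polynomial.C α * derivative^[2] (P i)) (x i) (x (i + 1)) (α * M) (κ * A)
      (by exact_mod_cast hF) (fun t => (hv t).differentiableAt) (H.glued.mono i hi)
      (by
        refine (natDegree_C_mul_le _ _).trans ?_
        rw [natDegree_iterate_derivative_eq]
        have := H.deg i hi
        omega)
      (fun t ht => by
        rw [iteratedDeriv_const_mul_field, iteratedDeriv_iteratedDeriv_eq, abs_mul,
          abs_of_pos hα]
        exact mul_le_mul_of_nonneg_left (H.bound _ (by omega) t (H.mem_Icc hi ht)) hα.le)
      (fun t ht => by
        rw [(hv t).deriv]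
        refine (abs_add_le _ _).trans ?_
        rw [abs_mul, abs_mul, abs_of_nonneg hγ]
        have h2 := mul_le_mul_of_nonneg_left (hstab i hi t ht 2 le_rfl) (abs_nonneg β)
        have h3 := hstab i hi t ht 1 (by omega)
        rw [iteratedDeriv_one] at h3
        have h3 := mul_le_mul_of_nonneg_left h3 hγ
        rw [hκ]
        linarith)
      (fun g hg => by rw [hform]; exact H.gauss i hi g hg) (T i) (hT i hi)
    rw [hform, ← hAdef] at h1
    have hpow : (x (i + 1) - x i) ^ (m + 1) ≤ h ^ (m + 1) :=
      pow_le_pow_left₀ hl0.le (H.le_h i hi) _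
    have h2 : α * M * (x (i + 1) - x i) ^ (m + 1) ≤ α * M * h ^ (m + 1) :=
      mul_le_mul_of_nonneg_left hpow (by positivity)
    have h3 : κ * A * (x (i + 1) - x i) ≤ κ * A * h :=
      mul_le_mul_of_nonneg_left (H.le_h i hi) (by positivity)
    have h4 : C₂ * (κ * A * h) ≤ A / 2 := by
      rw [le_div_iff₀ (by positivity)] at hh
      nlinarith [mul_nonneg hA0 (mul_nonneg hC₂0.le hh0.le)]
    have h5 := mul_le_mul_of_nonneg_left (add_le_add h2 h3) hC₂0.le
    linarith
  intro j hj t ht r hr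
  refine (hstab j hj t ht r hr).trans ?_
  rw [mul_assoc]
  exact mul_le_mul_of_nonneg_left hAle hC₁0.le

/-- On fine meshes all derivatives of the error are bounded. -/
lemma exists_all_derivatives_bound (m : ℕ) {α β γ d c : ℝ} (hα : 0 < α) (hγ : 0 ≤ γ)
    (hd : 0 < d) (hc : 1 ≤ c) (G : Finset ℝ) (hGc : m + 1 ≤ G.card)
    (hG : ∀ g ∈ G, g ∈ Set.Icc (-1 : ℝ) 1) :
    ∃ C > 0, ∃ h₀ > 0, h₀ ≤ 1 ∧
      ∀ (N : ℕ) (x : ℕ → ℝ) (h M : ℝ) (u : ℝ → ℝ) (P : ℕ → ℝ[X]),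
      IsCollocation m α β γ d c G N x h M u P → h ≤ h₀ → ∀ j < N,
        ∀ t ∈ Set.Icc (x j) (x (j + 1)),
          |iteratedDeriv 2 (pieceError u P j) t| ≤ C * (h ^ (m + 1) * M) ∧
          ∀ r ≤ 2 * m + 4, |iteratedDeriv r (pieceError u P j) t| ≤ C * M := by
  obtain ⟨C₁, hC₁0, h₁, hh₁, hC₁⟩ := exists_second_order_bound m (β := β) c hα hγ hd G hGc hG
  obtain ⟨C₂, hC₂0, hC₂⟩ := exists_derivative_bound m
  have hc0 : 0 < c := by linarith
  refine ⟨C₁ + 1 + C₂ * ((1 + C₁) * c ^ m), by positivity, min h₁ 1, by positivity,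
    min_le_right _ _, fun N x h M u P H hh j hj t ht => ?_⟩
  have hu := H.smooth
  have hh0 := H.h_pos
  have hM0 := H.M_nonneg
  have hle1 : h ≤ 1 := hh.trans (min_le_right _ _)
  have hlow := hC₁ N x h M u P H (hh.trans (min_le_left _ _)) j hj
  have hpos : 0 ≤ C₂ * ((1 + C₁) * c ^ m) * M := by positivity
  refine ⟨(hlow t ht 2 le_rfl).trans (mul_le_mul_of_nonneg_right ?_ (by positivity)),
    fun r hr => ?_⟩
  · have : 0 ≤ C₂ * ((1 + C₁) * c ^ m) := by positivity
    linarith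
  have hpow1 : h ^ (m + 1) ≤ 1 := pow_le_one₀ hh0.le hle1
  rcases lt_or_ge r 2 with hr2 | hr2
  · have h1 := hlow t ht r hr2.le
    have h2 : C₁ * (h ^ (m + 1) * M) ≤ C₁ * M := by
      refine mul_le_mul_of_nonneg_left ?_ hC₁0.le
      exact mul_le_of_le_one_left hM0 hpow1
    linarith
  obtain ⟨i, rfl⟩ : ∃ i, r = i + 2 := ⟨r - 2, by omega⟩
  have hub := H.bound (i + 2) hr t (H.mem_Icc hj ht)
  rcases le_or_gt i m with him | him
  · have hF : ContDiff ℝ (m + 1 : ℕ) (iteratedDeriv 2 u) :=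
      contDiff_iteratedDeriv hu (by omega)
    have hl0 : 0 < x (j + 1) - x j := sub_pos.2 (H.glued.mono j hj)
    have h1 := hC₂ (iteratedDeriv 2 u) (derivative^[2] (P j)) (x j) (x (j + 1)) M
      (C₁ * (h ^ (m + 1) * M)) (by exact_mod_cast hF) (H.glued.mono j hj)
      (by
        rw [natDegree_iterate_derivative_eq]
        have := H.deg j hj
        omega)
      (fun t ht => by
        rw [iteratedDeriv_iteratedDeriv_eq]
        exact H.bound _ (by omega) t (H.mem_Icc hj ht))
      (fun t ht => by
        rw [← iteratedDeriv_pieceError hu P j (by omega)]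
        exact hlow t ht 2 le_rfl) i him t ht
    rw [iteratedDeriv_iteratedDeriv_eq, ← Function.iterate_add_apply,
      ← iteratedDeriv_pieceError hu P j hr] at h1
    have h2 : (M * (x (j + 1) - x j) ^ (m + 1) + C₁ * (h ^ (m + 1) * M)) / (x (j + 1) - x j) ^ i
        ≤ (1 + C₁) * c ^ m * M := by
      rw [div_le_iff₀ (by positivity)]
      have h3 : (x (j + 1) - x j) ^ (m + 1) ≤ h ^ (m + 1) :=
        pow_le_pow_left₀ hl0.le (H.le_h j hj) _
      have h4 : h ^ (m + 1) ≤ c ^ m * (x (j + 1) - x j) ^ i := by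
        calc h ^ (m + 1) ≤ h ^ i := pow_le_pow_of_le_one hh0.le hle1 (by omega)
          _ ≤ (c * (x (j + 1) - x j)) ^ i := pow_le_pow_left₀ hh0.le (H.quasi j hj) _
          _ = c ^ i * (x (j + 1) - x j) ^ i := mul_pow _ _ _
          _ ≤ c ^ m * (x (j + 1) - x j) ^ i :=
            mul_le_mul_of_nonneg_right (pow_le_pow_right₀ hc him) (by positivity)
      calc M * (x (j + 1) - x j) ^ (m + 1) + C₁ * (h ^ (m + 1) * M)
          ≤ M * h ^ (m + 1) + C₁ * (h ^ (m + 1) * M) := by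
            have := mul_le_mul_of_nonneg_left h3 hM0
            linarith
        _ = (1 + C₁) * M * h ^ (m + 1) := by ring
        _ ≤ (1 + C₁) * M * (c ^ m * (x (j + 1) - x j) ^ i) :=
            mul_le_mul_of_nonneg_left h4 (by positivity)
        _ = _ := by ring
    have h3 := mul_le_mul_of_nonneg_left h2 hC₂0.le
    have h4 : 0 ≤ C₁ * M := by positivity
    linarith
  · have hz : derivative^[i + 2] (P j) = 0 :=
      iterate_derivative_eq_zero (by have := H.deg j hj; omega)
    rw [iteratedDeriv_pieceError hu P j hr, hz, eval_zero, sub_zero]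
    have h4 : 0 ≤ C₁ * M := by positivity
    linarith

end Collocation

section Superconvergence

open Polynomial

/-- The error and its derivative are of order `m + 3` at the mesh points, provided that the
derivatives of the error are bounded. -/
lemma exists_nodal_bound (m : ℕ) (hm : 1 ≤ m) {α β γ d : ℝ} (c : ℝ) (hα : 0 < α) (hγ : 0 ≤ γ)
    (hd : 0 < d) (G : Finset ℝ) (hGc : m + 1 ≤ G.card)
    (hG : ∀ g ∈ G, g ∈ Set.Icc (-1 : ℝ) 1) (hroot : ∀ g ∈ G, (rodrigues (m + 1)).eval g = 0) :
    ∃ C > 0, ∀ (N : ℕ) (x : ℕ → ℝ) (h M : ℝ) (u : ℝ → ℝ) (P : ℕ → ℝ[X]) (K : ℝ),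
      IsCollocation m α β γ d c G N x h M u P →
      (∀ j < N, ∀ t ∈ Set.Icc (x j) (x (j + 1)), ∀ r ≤ 2 * m + 4,
        |iteratedDeriv r (pieceError u P j) t| ≤ K) →
      ∀ i < N, |pieceError u P i (x i)| ≤ C * (h ^ (m + 3) * K) ∧
        |deriv (pieceError u P i) (x i)| ≤ C * (h ^ (m + 3) * K) := by
  obtain ⟨S, E, hSE⟩ := exists_isDualPair (β := β) hα hγ hd
  obtain ⟨C, hC0, hC⟩ := exists_stability_bound hα hSE
  obtain ⟨B₁, hB₁0, hB₁⟩ := exists_bound_iteratedDeriv hSE.solS.1 (m + 3) (-d) 0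
  obtain ⟨B₂, hB₂0, hB₂⟩ := exists_bound_iteratedDeriv hSE.solE.1 (m + 3) (-d) 0
  obtain ⟨C₀, hC₀0, hC₀⟩ := exists_integral_bound_of_nodes (by omega) G hGc hroot
  set A := |α| + |β| + |γ| with hA
  have hA0 : 0 < A := by positivity
  set B := B₁ + B₂ with hB
  set D := (C₀ + 1) * (2 ^ (m + 3) * (A * B)) * d with hD
  refine ⟨C * D, by positivity, fun N x h M u P K H hK i hi => ?_⟩
  have hN := H.glued.one_le
  have hh0 := H.h_pos
  have hK0 : 0 ≤ K := (abs_nonneg _).trans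
    (hK i hi (x i) ⟨le_rfl, (H.glued.mono i hi).le⟩ 0 (by omega))
  have helem : ∀ ψ : ℝ → ℝ, ContDiff ℝ (m + 3 : ℕ) ψ →
      (∀ r ≤ m + 3, ∀ t ∈ Set.Icc (-d) 0, |iteratedDeriv r ψ t| ≤ B) →
      ∀ j < N, ∀ y, x (j + 1) ≤ y → y ≤ x N →
      |∫ t in (x j)..(x (j + 1)), diffOp α β γ (pieceError u P j) t * ψ (t - y)|
        ≤ (C₀ + 1) * (2 ^ (m + 3) * (A * B)) * (h ^ (m + 3) * K) * (x (j + 1) - x j) := by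
    intro ψ hψ hψB j hj y hy hyN
    have hmono := H.glued.mono j hj
    have he : ContDiff ℝ (2 * m + 4 : ℕ) (pieceError u P j) := contDiff_pieceError H.smooth P j
    have hF1 : ContDiff ℝ (m + 3 : ℕ) (diffOp α β γ (pieceError u P j)) :=
      contDiff_diffOp he (by omega)
    have hF2 : ContDiff ℝ (m + 3 : ℕ) (fun t => ψ (t - y)) :=
      hψ.comp (contDiff_id.sub contDiff_const)
    have hintegral := abs_integral_le_of_vanishing (m := m + 2) (s := 1) hG (by norm_num)
      (fun T δ => hC₀ (m + 2) 1 (by norm_num)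
        (fun q hq => integral_rodrigues_mul_linear (by omega) (by omega)) T δ)
      (F := fun t => diffOp α β γ (pieceError u P j) t * ψ (t - y)) (p := x j) (q := x (j + 1))
      (K := 2 ^ (m + 3) * (A * K * B)) (by exact_mod_cast hF1.mul hF2) hmono.le
      (fun t ht => by
        refine abs_iteratedDeriv_mul_le hF1 hF2 (fun r hr => ?_) (fun r hr => ?_)
        · exact abs_iteratedDeriv_diffOp_le he (by omega) (hK j hj t ht)
        · rw [iteratedDeriv_comp_sub_const]
          have h0 : x 0 ≤ x j := mesh_le H.glued.mono (by omega) (by omega)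
          have hl := H.length
          exact hψB r hr _ ⟨by linarith [ht.1], by linarith [ht.2]⟩)
      (fun g hg => by rw [H.gauss j hj g hg, zero_mul])
    have hend : affMap (x j) (x (j + 1)) 1 = x (j + 1) := by
      unfold affMap
      ring
    rw [hend] at hintegral
    refine hintegral.trans ?_
    have hl0 : 0 ≤ x (j + 1) - x j := sub_nonneg.2 hmono.le
    have hpow : (x (j + 1) - x j) ^ (m + 3) ≤ h ^ (m + 3) :=
      pow_le_pow_left₀ hl0 (H.le_h j hj) _
    have h1 := mul_le_mul_of_nonneg_left hpow
      (show 0 ≤ (C₀ + 1) * (2 ^ (m + 3) * (A * B)) * K * (x (j + 1) - x j) by positivity)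
    calc _ = (C₀ + 1) * (2 ^ (m + 3) * (A * B)) * K * (x (j + 1) - x j)
          * (x (j + 1) - x j) ^ (m + 3) := by ring
      _ ≤ _ := h1
      _ = _ := by ring
  have hscale : ∀ y ≤ x N, (C₀ + 1) * (2 ^ (m + 3) * (A * B)) * (h ^ (m + 3) * K) * (y - x 0)
      ≤ D * (h ^ (m + 3) * K) := by
    intro y hy
    have hl := H.length
    have h1 := mul_le_mul_of_nonneg_left (show y - x 0 ≤ d by linarith)
      (show 0 ≤ (C₀ + 1) * (2 ^ (m + 3) * (A * B)) * (h ^ (m + 3) * K) by positivity)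
    rw [hD]
    linarith
  have hmoment : ∀ ψ : ℝ → ℝ, ContDiff ℝ (m + 3 : ℕ) ψ →
      (∀ r ≤ m + 3, ∀ t ∈ Set.Icc (-d) 0, |iteratedDeriv r ψ t| ≤ B) →
      |moment x (fun j => diffOp α β γ (pieceError u P j)) (fun t => ψ (t - x i)) i (x i)|
        ≤ D * (h ^ (m + 3) * K) := by
    intro ψ hψ hψB
    have hxN : x i ≤ x N := mesh_le H.glued.mono hi.le le_rfl
    refine (abs_moment_le (fun j hj => helem ψ hψ hψB j (by omega) (x i)
      (mesh_le H.glued.mono (by omega) (by omega)) hxN) (by simp)).trans (hscale _ hxN)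
  have hS : ∀ r ≤ m + 3, ∀ t ∈ Set.Icc (-d) 0, |iteratedDeriv r S t| ≤ B := fun r hr t ht =>
    (hB₁ r hr t ht).trans (by linarith)
  have hE : ∀ r ≤ m + 3, ∀ t ∈ Set.Icc (-d) 0, |iteratedDeriv r E t| ≤ B := fun r hr t ht =>
    (hB₂ r hr t ht).trans (by linarith)
  have hSc := hSE.solS.contDiff (m + 3)
  have hlast : |moment x (fun j => diffOp α β γ (pieceError u P j)) (fun t => S (t - x N))
      (N - 1) (x N)| ≤ D * (h ^ (m + 3) * K) := by
    refine (abs_moment_le (fun j hj => helem S hSc hS j (by omega) (x N)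
      (mesh_le H.glued.mono (by omega) le_rfl) le_rfl) ?_).trans (hscale _ le_rfl)
    have h1 := helem S hSc hS (N - 1) (by omega) (x N)
    rw [Nat.sub_add_cancel hN] at h1
    exact h1 le_rfl le_rfl
  obtain ⟨h0, h1⟩ := hC N x (pieceError u P) _ H.glued H.length hlast i hi (x i)
    ⟨le_rfl, (H.glued.mono i hi).le⟩ (hmoment S hSc hS)
    (hmoment E (hSE.solE.contDiff (m + 3)) hE)
  rw [mul_assoc C]
  exact ⟨h0, h1⟩

/-- At the interior Lobatto points the derivative of the error is of order `m + 3`. -/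
lemma exists_lobatto_bound (m : ℕ) (hm : 1 ≤ m) {α β γ d c : ℝ} (hα : 0 < α) (hγ : 0 ≤ γ)
    (hd : 0 < d) (hc : 1 ≤ c) (G : Finset ℝ) (hGc : m + 1 ≤ G.card)
    (hG : ∀ g ∈ G, g ∈ Set.Icc (-1 : ℝ) 1) (hroot : ∀ g ∈ G, (rodrigues (m + 1)).eval g = 0) :
    ∃ C > 0, ∃ h₀ > 0, ∀ (N : ℕ) (x : ℕ → ℝ) (h M : ℝ) (u : ℝ → ℝ) (P : ℕ → ℝ[X]),
      IsCollocation m α β γ d c G N x h M u P → h ≤ h₀ → ∀ i < N, ∀ s ∈ Set.Ioo (-1 : ℝ) 1,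
        (derivative (rodrigues (m + 1))).eval s = 0 →
        |deriv (pieceError u P i) (affMap (x i) (x (i + 1)) s)| ≤ C * (h ^ (m + 3) * M) := by
  obtain ⟨C₁, hC₁0, h₀, hh₀, hh₀1, hC₁⟩ :=
    exists_all_derivatives_bound m (β := β) hα hγ hd hc G hGc hG
  obtain ⟨C₂, hC₂0, hC₂⟩ := exists_nodal_bound m hm (β := β) c hα hγ hd G hGc hG hroot
  obtain ⟨C₀, hC₀0, hC₀⟩ := exists_integral_bound_of_nodes (by omega) G hGc hroot
  set A := |α| + |β| + |γ| with hA
  have hA0 : 0 < A := by positivity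
  set C₃ := C₂ * C₁ + C₁ with hC₃
  have hC₃0 : 0 < C₃ := by positivity
  set C₄ := C₂ * C₁ + C₃ with hC₄
  have hC₄0 : 0 < C₄ := by positivity
  refine ⟨C₂ * C₁ + (|β| * C₃ + γ * C₄ + (C₀ + 1) * (A * C₁)) / α, by positivity, h₀, hh₀,
    fun N x h M u P H hh i hi s hs hs0 => ?_⟩
  have hh0 := H.h_pos
  have hh1 : h ≤ 1 := hh.trans hh₀1
  have hM0 := H.M_nonneg
  have hbound := hC₁ N x h M u P H hh
  obtain ⟨hval, hder⟩ := hC₂ N x h M u P (C₁ * M) H (fun j hj t ht => (hbound j hj t ht).2) i hi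
  rw [show C₂ * (h ^ (m + 3) * (C₁ * M)) = C₂ * C₁ * (h ^ (m + 3) * M) by ring] at hval hder
  have hmono := H.glued.mono i hi
  have hl0 : 0 < x (i + 1) - x i := sub_pos.2 hmono
  have hlh := H.le_h i hi
  set e := pieceError u P i with he
  have he' : ContDiff ℝ (2 * m + 4 : ℕ) e := contDiff_pieceError H.smooth P i
  have he2 : ContDiff ℝ 2 e := H.glued.smooth i hi
  set y := affMap (x i) (x (i + 1)) s with hy
  have hyI : y ∈ Set.Icc (x i) (x (i + 1)) := affMap_mem_Icc hmono.le ⟨hs.1.le, hs.2.le⟩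
  have hxI : x i ∈ Set.Icc (x i) (x (i + 1)) := ⟨le_rfl, hmono.le⟩
  have hpow0 : 0 ≤ h ^ (m + 3) * M := by positivity
  have hpow1 : h ^ (m + 3) * M ≤ h ^ (m + 2) * M :=
    mul_le_mul_of_nonneg_right (pow_le_pow_of_le_one hh0.le hh1 (by omega)) hM0
  have hderI : ∀ t ∈ Set.Icc (x i) (x (i + 1)), |deriv e t| ≤ C₃ * (h ^ (m + 2) * M) := by
    intro t ht
    have h1 := abs_sub_le_of_abs_deriv_le (f := deriv e)
      (fun t => (hasDerivAt_deriv_of_contDiff_two he2 t).2.differentiableAt)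
      (fun t ht => by
        rw [(hasDerivAt_deriv_of_contDiff_two he2 t).2.deriv]
        exact (hbound i hi t ht).1) hxI ht
    have h2 : C₁ * (h ^ (m + 1) * M) * (x (i + 1) - x i) ≤ C₁ * (h ^ (m + 2) * M) := by
      have := mul_le_mul_of_nonneg_left hlh (show 0 ≤ C₁ * (h ^ (m + 1) * M) by positivity)
      refine this.trans_eq ?_
      ring
    have h3 := abs_sub_abs_le_abs_sub (deriv e t) (deriv e (x i))
    have h4 := mul_le_mul_of_nonneg_left hpow1 (show 0 ≤ C₂ * C₁ by positivity)
    rw [hC₃]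
    linarith
  have hvarI : ∀ t ∈ Set.Icc (x i) (x (i + 1)), |e t - e (x i)| ≤ C₃ * (h ^ (m + 3) * M) := by
    intro t ht
    refine (abs_sub_le_of_abs_deriv_le
      (fun t => (hasDerivAt_deriv_of_contDiff_two he2 t).1.differentiableAt) hderI hxI ht).trans ?_
    refine (mul_le_mul_of_nonneg_left hlh (by positivity)).trans_eq ?_
    ring
  have hint_e : |∫ t in (x i)..y, e t| ≤ C₄ * (h ^ (m + 3) * M) := by
    have h1 := abs_integral_mul_le (F := e) (ψ := fun _ => 1) (B := 1)
      (A := C₄ * (h ^ (m + 3) * M)) hyI.1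
      (fun t ht => by
        have h2 := hvarI t ⟨ht.1, ht.2.trans hyI.2⟩
        have h3 := abs_sub_abs_le_abs_sub (e t) (e (x i))
        rw [hC₄]
        linarith) (by simp)
    simp only [mul_one] at h1
    refine h1.trans (mul_le_of_le_one_right (by positivity) ?_)
    linarith [hyI.2]
  have hintegral : |∫ t in (x i)..y, diffOp α β γ e t|
      ≤ (C₀ + 1) * (A * C₁) * (h ^ (m + 3) * M) := by
    have h1 := abs_integral_le_of_vanishing (m := m + 1) (s := s) hG ⟨hs.1.le, hs.2.le⟩
      (fun T δ => hC₀ (m + 1) s ⟨hs.1.le, hs.2.le⟩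
        (fun q hq => by
          rw [eq_C_of_natDegree_le_zero (p := q) (by omega)]
          simp only [eval_mul, eval_C, intervalIntegral.integral_mul_const]
          rw [integral_rodrigues_lobatto (by omega) hs0, zero_mul]) T δ)
      (F := diffOp α β γ e) (p := x i) (q := x (i + 1)) (K := A * (C₁ * M))
      (by exact_mod_cast contDiff_diffOp (n := m + 2) he' (by omega)) hmono.le
      (fun t ht => abs_iteratedDeriv_diffOp_le he' (by omega) (hbound i hi t ht).2)
      (H.gauss i hi)
    refine h1.trans ?_
    have hpow : (x (i + 1) - x i) ^ (m + 3) ≤ h ^ (m + 3) := pow_le_pow_left₀ hl0.le hlh _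
    have h2 := mul_le_mul_of_nonneg_left hpow
      (show 0 ≤ (C₀ + 1) * (A * C₁) * M by positivity)
    calc _ = (C₀ + 1) * (A * C₁) * M * (x (i + 1) - x i) ^ (m + 3) := by ring
      _ ≤ _ := h2
      _ = _ := by ring
  have hprim : ∫ t in (x i)..y, (diffOp α β γ e t - γ * e t)
      = (-α * deriv e y + β * e y) - (-α * deriv e (x i) + β * e (x i)) := by
    refine intervalIntegral.integral_eq_sub_of_hasDerivAt
      (f := fun t => -α * deriv e t + β * e t) (fun t _ => ?_) ?_
    · obtain ⟨h1, h2⟩ := hasDerivAt_deriv_of_contDiff_two he2 t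
      refine ((h2.const_mul (-α)).add (h1.const_mul β)).congr_deriv ?_
      rw [diffOp]
      ring
    · exact ((continuous_diffOp he2).sub (continuous_const.mul he2.continuous)).intervalIntegrable
        _ _
  rw [intervalIntegral.integral_sub ((continuous_diffOp he2).intervalIntegrable _ _)
    ((he2.continuous.intervalIntegrable _ _).const_mul γ),
    intervalIntegral.integral_const_mul] at hprim
  have hkey : α * |deriv e y - deriv e (x i)|
      ≤ (|β| * C₃ + γ * C₄ + (C₀ + 1) * (A * C₁)) * (h ^ (m + 3) * M) := by
    rw [show ∀ r : ℝ, α * |r| = |α * r| from fun r => by rw [abs_mul, abs_of_pos hα],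
      show α * (deriv e y - deriv e (x i)) = β * (e y - e (x i)) + γ * (∫ t in (x i)..y, e t)
        + -∫ t in (x i)..y, diffOp α β γ e t by linarith]
    refine (abs_add_three _ _ _).trans ?_
    rw [abs_neg, abs_mul, abs_mul, abs_of_nonneg hγ]
    have h1 := mul_le_mul_of_nonneg_left (hvarI y hyI) (abs_nonneg β)
    have h2 := mul_le_mul_of_nonneg_left hint_e hγ
    linarith
  have hquot : |deriv e y - deriv e (x i)|
      ≤ (|β| * C₃ + γ * C₄ + (C₀ + 1) * (A * C₁)) / α * (h ^ (m + 3) * M) := by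
    rw [div_mul_eq_mul_div, le_div_iff₀ hα]
    linarith
  have h3 := abs_sub_abs_le_abs_sub (deriv e y) (deriv e (x i))
  rw [add_mul]
  linarith

end Superconvergence

lemma IsGaussSol.isCollocation {m N : ℕ} {α β γ a b c h M : ℝ} {G : Finset ℝ} {x : ℕ → ℝ}
    {u : ℝ → ℝ} {Pb : ℕ → Polynomial ℝ} (hab : a < b) (hx : IsMesh a b N x)
    (hh : IsMeshSize N x h) (hq : IsQuasiUniform N x h c) (hu : ContDiff ℝ (2 * m + 4 : ℕ) u)
    (hua : u a = 0) (hub : u b = 0)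
    (hP : IsGaussSol (m + 2) N x α β γ
      (fun t => -α * iteratedDeriv 2 u t + β * deriv u t + γ * u t) Pb)
    (hM : ∀ j ≤ 2 * m + 4, ∀ y ∈ Set.Ioo a b, |iteratedDeriv j u y| ≤ M)
    (hG : ∀ g ∈ G, g ∈ Set.Ioo (-1 : ℝ) 1 ∧ (rodrigues (m + 1)).eval g = 0) :
    IsCollocation m α β γ (b - a) c G N x h M u (fun j => Pb (j + 1)) := by
  obtain ⟨hN, hxa, hxb, hmono⟩ := hx
  obtain ⟨⟨hdeg, hval, hder, hleft, hright⟩, hgauss⟩ := hP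
  have hmem : ∀ j < N, j + 1 ∈ Finset.Icc 1 N := fun j hj => Finset.mem_Icc.2 ⟨by omega, hj⟩
  have hmem' : ∀ j, j + 1 < N → j + 1 ∈ Finset.Icc 1 (N - 1) := fun j hj =>
    Finset.mem_Icc.2 ⟨by omega, by omega⟩
  have hderiv : ∀ j t, deriv (pieceError u (fun j => Pb (j + 1)) j) t
      = deriv u t - (Polynomial.derivative (Pb (j + 1))).eval t := fun j t => by
    rw [← iteratedDeriv_one, iteratedDeriv_pieceError hu _ j (by omega), iteratedDeriv_one,
      Function.iterate_one]
  refine ⟨⟨hN, hmono, fun j _ => ?_, fun j hj => ?_, fun j hj => ?_, ?_, ?_⟩, hu, by rw [hxa, hxb],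
    fun j hj => by simpa using hh.1 (j + 1) (hmem j hj),
    fun j hj => by simpa using hq (j + 1) (hmem j hj), fun j hj => hdeg (j + 1) (hmem j hj),
    fun j hj g hg => ?_, fun i hi => ?_⟩
  · exact (contDiff_pieceError hu _ j).of_le (by norm_cast; omega)
  · rw [pieceError, pieceError, hval (j + 1) (hmem' j hj)]
  · rw [hderiv, hderiv, hder (j + 1) (hmem' j hj)]
  · rw [pieceError, hleft, hxa, hua, sub_zero]
  · rw [pieceError, Nat.sub_add_cancel hN, hright, hxb, hub, sub_zero]
  · have h1 := hgauss (j + 1) (hmem j hj) g (hG g hg).1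
      (legendre_eq_zero_of_rodrigues (hG g hg).2)
    rw [Nat.add_sub_cancel] at h1
    rw [diffOp, hderiv, iteratedDeriv_pieceError hu _ j (by omega), pieceError]
    simp only [Function.iterate_succ, Function.iterate_zero, Function.comp_apply, id]
    linear_combination -h1
  · have hclosed : IsClosed {y | |iteratedDeriv i u y| ≤ M} :=
      isClosed_le (hu.continuous_iteratedDeriv i (by exact_mod_cast hi)).abs continuous_const
    rw [hxa, hxb, ← closure_Ioo hab.ne]
    exact hclosed.closure_subset_iff.2 (hM i hi)

/-- Superconvergence of the derivative of the Gauss collocation solution at the interior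
Lobatto points (images of the roots of `L_{k-1}'`):
`|(u - ū_h)'(gl_{in})| ≤ C h^{k+1} ‖u‖_{2k,∞}`. -/
theorem gauss_collocation_superconvergence_lobatto_points (k : ℕ) (hk : 3 ≤ k)
    (α β γ c d : ℝ) (hα : 0 < α) (hγ : 0 ≤ γ) (hc : 1 ≤ c) (hd : 0 < d) :
    ∃ C > 0, ∃ h₀ > 0, ∀ (a b : ℝ), b - a = d →
      ∀ (N : ℕ) (x : ℕ → ℝ) (h : ℝ),
        IsMesh a b N x → IsMeshSize N x h → IsQuasiUniform N x h c → h ≤ h₀ →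
      ∀ u : ℝ → ℝ, ContDiff ℝ (2 * k) u → u a = 0 → u b = 0 →
      ∀ Pb : ℕ → Polynomial ℝ,
        IsGaussSol k N x α β γ (fun t => -α * iteratedDeriv 2 u t + β * deriv u t + γ * u t) Pb →
      ∀ M : ℝ, (∀ j ≤ 2 * k, ∀ y ∈ Set.Ioo a b, |iteratedDeriv j u y| ≤ M) →
        ∀ i ∈ Finset.Icc 1 N, ∀ s ∈ Set.Ioo (-1 : ℝ) 1, deriv (legendre (k - 1)) s = 0 →
          |deriv u (affMap (x (i - 1)) (x i) s)
              - (Polynomial.derivative (Pb i)).eval (affMap (x (i - 1)) (x i) s)|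
            ≤ C * h ^ (k + 1) * M := by
  obtain ⟨m, rfl⟩ : ∃ m, k = m + 2 := ⟨k - 2, by omega⟩
  obtain ⟨G, hGc, hG⟩ := exists_gauss_nodes (m + 1)
  obtain ⟨C, hC0, h₀, hh₀, hC⟩ := exists_lobatto_bound m (by omega) (β := β) hα hγ hd hc G hGc
    (fun g hg => Set.Ioo_subset_Icc_self (hG g hg).1) (fun g hg => (hG g hg).2)
  refine ⟨C, hC0, h₀, hh₀, ?_⟩
  intro a b hab N x h hx hh hq hle u hu hua hub Pb hP M hM i hi s hs hs0
  obtain ⟨hi1, hiN⟩ := Finset.mem_Icc.1 hi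
  have hu' : ContDiff ℝ (2 * m + 4 : ℕ) u := by
    convert hu using 1
    push_cast
    ring
  have H := IsGaussSol.isCollocation (by linarith) hx hh hq hu' hua hub hP
    (fun j hj => hM j (by omega)) hG
  rw [hab] at H
  have h1 := hC N x h M u _ H hle (i - 1) (by omega) s hs (derivative_rodrigues_eq_zero hs0)
  rw [← iteratedDeriv_one, iteratedDeriv_pieceError hu' _ _ (by omega), iteratedDeriv_one,
    Function.iterate_one, Nat.sub_add_cancel hi1] at h1
  rw [mul_assoc]
  exact h1
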